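/- arXiv:1506.01699 — 2 statements merged into one kernel-verified Lean document; each statement's English description precedes it below -/
import Mathlib

section
/- (Corollary 3.4, trace estimate for the cofactor matrix.) Assume λ ≤ det D²u ≤ Λ in Ω, let V ⊂⊂ Ω be open, let x₀ ∈ V and 0 < t < 1/4, and assume V admits a Green's function of L_u with pole x₀. If n ≥ 3 and S_u(x₀, 2t) ⊂⊂ V, then there is a constant C depending only on n, λ, Λ such that ∫_{S_u(x₀, t)} trace(U) dx ≤ C · t^{(n-2)/2} · ( max_{x ∈ ∂V} |x|² − |x₀|² ). If n = 2 and S_u(x₀, t^{1/2}) ⊂⊂ V, then there is a constant C depending only on λ, Λ such that ∫_{S_u(x₀, t)} trace(U) dx ≤ C · |log t|^{-1} · ( max_{x ∈ ∂V} |x|² − |x₀|² ). -/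
open MeasureTheory

noncomputable section

/-- Euclidean space `ℝⁿ`. -/
abbrev E (n : ℕ) := EuclideanSpace ℝ (Fin n)

/-- First partial derivative `∂_i f (x)`. -/
noncomputable def pd {n : ℕ} (f : E n → ℝ) (x : E n) (i : Fin n) : ℝ :=
  fderiv ℝ f x (EuclideanSpace.single i 1)

/-- Second partial derivative `∂_{ij} f (x)`. -/
noncomputable def pd2 {n : ℕ} (f : E n → ℝ) (x : E n) (i j : Fin n) : ℝ :=
  fderiv ℝ (fun y => fderiv ℝ f y (EuclideanSpace.single j 1)) x (EuclideanSpace.single i 1)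

/-- Hessian matrix `D²f(x)`. -/
noncomputable def Hess {n : ℕ} (f : E n → ℝ) (x : E n) : Matrix (Fin n) (Fin n) ℝ :=
  Matrix.of fun i j => pd2 f x i j

/-- The cofactor matrix `U = (det D²u)(D²u)⁻¹` of the Hessian of `u`,
realized as the adjugate. -/
noncomputable def cofU {n : ℕ} (u : E n → ℝ) (x : E n) : Matrix (Fin n) (Fin n) ℝ :=
  (Hess u x).adjugate

/-- Section of the convex function `u`:
`S_u(x₀,t) = {x ∈ cl Ω : u x < u x₀ + ∇u(x₀)·(x - x₀) + t}`. -/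
def MASection {n : ℕ} (Ω : Set (E n)) (u : E n → ℝ) (x₀ : E n) (t : ℝ) : Set (E n) :=
  {x ∈ closure Ω | u x < u x₀ + fderiv ℝ u x₀ (x - x₀) + t}

/-- `A ⊂⊂ B`: the closure of `A` is a compact subset of `B`. -/
def CptIn {n : ℕ} (A B : Set (E n)) : Prop :=
  IsCompact (closure A) ∧ closure A ⊆ B

/-- Uniform convexity of a domain: balls of radius proportional to `‖x - y‖²`
centered at midpoints of points of the closure stay in the closure. -/
def UnifConvex {n : ℕ} (Ω : Set (E n)) : Prop :=
  ∃ δ > 0, ∀ x ∈ closure Ω, ∀ y ∈ closure Ω,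
    Metric.closedBall (midpoint ℝ x y) (δ * ‖x - y‖ ^ 2) ⊆ closure Ω

/-- Standing assumptions: `Ω` is a bounded, open, nonempty, uniformly convex domain and
`u` is a smooth convex function on `cl Ω` vanishing on `∂Ω`. -/
def MASetup {n : ℕ} (Ω : Set (E n)) (u : E n → ℝ) : Prop :=
  IsOpen Ω ∧ Bornology.IsBounded Ω ∧ Ω.Nonempty ∧ UnifConvex Ω ∧
  ContDiffOn ℝ (⊤ : ℕ∞) u (closure Ω) ∧ ConvexOn ℝ (closure Ω) u ∧
  ∀ x ∈ frontier Ω, u x = 0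

/-- `λ ≤ det D²u ≤ Λ` in `Ω`. -/
def DetBounds {n : ℕ} (Ω : Set (E n)) (u : E n → ℝ) (lam Lam : ℝ) : Prop :=
  ∀ x ∈ Ω, lam ≤ (Hess u x).det ∧ (Hess u x).det ≤ Lam

/-- The Monge-Ampère measure of `u`: `μ(A) = ∫_A det D²u`. -/
noncomputable def maMeasure {n : ℕ} (u : E n → ℝ) (A : Set (E n)) : ℝ :=
  ∫ x in A, (Hess u x).det

/-- Center of mass of a set. -/
noncomputable def centerOfMass {n : ℕ} (S : Set (E n)) : E n :=
  (volume S).toReal⁻¹ • ∫ x in S, x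

/-- The `α`-dilation of `S` with respect to its center of mass. -/
def dilateCM {n : ℕ} (α : ℝ) (S : Set (E n)) : Set (E n) :=
  (fun x => centerOfMass S + α • (x - centerOfMass S)) '' S

/-- The Monge-Ampère measure of `u` is doubling with respect to the center of mass
on the sections of `u`, with constants `0 < α < 1 < β`. -/
def DoublingCM {n : ℕ} (Ω : Set (E n)) (u : E n → ℝ) (α β : ℝ) : Prop :=
  0 < α ∧ α < 1 ∧ 1 < β ∧
  ∀ x₀ ∈ Ω, ∀ t : ℝ, 0 < t → CptIn (MASection Ω u x₀ t) Ω →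
    maMeasure u (MASection Ω u x₀ t) ≤ β * maMeasure u (dilateCM α (MASection Ω u x₀ (t / 2)))

/-- `g` is a Green's function of the linearized Monge-Ampère operator `L_u` in `V`
with pole `y`: positive and smooth on `V \ {y}`, `L_u`-harmonic there, vanishing
continuously on `∂V`, and `∫_V g · (L_u φ) = φ(y)` (i.e. `∫_V g · U^{ij}∂_{ij}φ = -φ(y)`)
for all test functions `φ`. -/
def IsGreen {n : ℕ} (u : E n → ℝ) (V : Set (E n)) (y : E n) (g : E n → ℝ) : Prop :=
  (∀ x ∈ V \ {y}, 0 < g x) ∧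
  ContDiffOn ℝ (⊤ : ℕ∞) g (V \ {y}) ∧
  (∀ x ∈ V \ {y}, ∑ i, ∑ j, cofU u x i j * pd2 g x i j = 0) ∧
  ContinuousOn g (closure V \ {y}) ∧
  (∀ x ∈ frontier V, g x = 0) ∧
  ∀ φ : E n → ℝ, ContDiff ℝ (⊤ : ℕ∞) φ → HasCompactSupport φ → tsupport φ ⊆ V →
    (∫ x in V, g x * ∑ i, ∑ j, cofU u x i j * pd2 φ x i j) = -φ y

/-- Capacity of a compact set `K` relative to `V` for the operator `L_u`:
the infimum of `∫_V U^{ij} ∂_iΦ ∂_jΦ` over Lipschitz `Φ` compactly supported in `V`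
with `Φ ≥ 1` on `K`. -/
noncomputable def capacity {n : ℕ} (u : E n → ℝ) (K V : Set (E n)) : ℝ :=
  sInf { e : ℝ | ∃ Φ : E n → ℝ, (∃ L : NNReal, LipschitzWith L Φ) ∧
    HasCompactSupport Φ ∧ tsupport Φ ⊆ V ∧ (∀ x ∈ K, 1 ≤ Φ x) ∧
    e = ∫ x in V, ∑ i, ∑ j, cofU u x i j * pd Φ x i * pd Φ x j }

section

variable {n : ℕ}

/-- Jacobi's formula along a curve of matrices. -/
theorem hasDerivAt_matrix_det {M : ℝ → Matrix (Fin n) (Fin n) ℝ} {M' : Matrix (Fin n) (Fin n) ℝ}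
    {t : ℝ} (h : ∀ i j, HasDerivAt (fun s => M s i j) (M' i j) t) :
    HasDerivAt (fun s => (M s).det) (∑ i, ∑ j, (M t).adjugate j i * M' i j) t := by
  have h1 : HasDerivAt (fun s => (M s).det)
      (∑ σ : Equiv.Perm (Fin n), ((Equiv.Perm.sign σ : ℤ) : ℝ) *
        ∑ i, (∏ k ∈ Finset.univ.erase i, M t (σ k) k) * M' (σ i) i) t := by
    simp only [Matrix.det_apply']
    refine HasDerivAt.fun_sum fun σ _ => HasDerivAt.const_mul _ ?_
    simpa [smul_eq_mul] using HasDerivAt.fun_finsetProd (u := Finset.univ) (x := t)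
      (f := fun i s => M s (σ i) i) (f' := fun i => M' (σ i) i) (fun i _ => h (σ i) i)
  convert h1 using 1
  have h2 : ∀ i, ∑ j, (M t).adjugate i j * M' j i = ((M t).updateCol i (fun j => M' j i)).det := by
    intro i
    rw [← Matrix.cramer_apply, Matrix.cramer_eq_adjugate_mulVec]
    rfl
  rw [Finset.sum_comm]
  simp only [h2, Matrix.det_apply', Finset.mul_sum]
  rw [Finset.sum_comm]
  refine Finset.sum_congr rfl fun σ _ => Finset.sum_congr rfl fun i _ => ?_
  rw [← Finset.mul_prod_erase _ _ (Finset.mem_univ i)]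
  simp only [Matrix.updateCol_self]
  rw [mul_comm (M' _ _)]
  congr 2
  refine Finset.prod_congr rfl fun k hk => ?_
  rw [Matrix.updateCol_ne (Finset.ne_of_mem_erase hk)]

theorem DifferentiableAt.hasDerivAt_coord_line {f : E n → ℝ} {x : E n}
    (hf : DifferentiableAt ℝ f x) (i : Fin n) :
    HasDerivAt (fun s : ℝ => f (x + s • EuclideanSpace.single i 1)) (pd f x i) 0 :=
  hf.hasFDerivAt.hasLineDerivAt _

theorem pd_eq_of_hasDerivAt {f : E n → ℝ} {x : E n} (hf : DifferentiableAt ℝ f x) {i : Fin n}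
    {c : ℝ} (h : HasDerivAt (fun s : ℝ => f (x + s • EuclideanSpace.single i 1)) c 0) :
    pd f x i = c :=
  (hf.hasDerivAt_coord_line i).unique h

theorem ContDiffAt.pd {f : E n → ℝ} {x : E n} (hf : ContDiffAt ℝ (⊤ : ℕ∞) f x) (i : Fin n) :
    ContDiffAt ℝ (⊤ : ℕ∞) (fun y => pd f y i) x := by
  have h : ContDiffAt ℝ (⊤ : ℕ∞) (fderiv ℝ f) x := hf.fderiv_right (by simp)
  exact h.clm_apply contDiffAt_const

theorem ContDiffAt.hess {f : E n → ℝ} {x : E n} (hf : ContDiffAt ℝ (⊤ : ℕ∞) f x) (i j : Fin n) :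
    ContDiffAt ℝ (⊤ : ℕ∞) (fun y => Hess f y i j) x :=
  (hf.pd j).pd i

theorem ContDiffAt.matrix_det {x : E n} {M : E n → Matrix (Fin n) (Fin n) ℝ}
    (hM : ∀ i j, ContDiffAt ℝ (⊤ : ℕ∞) (fun y => M y i j) x) :
    ContDiffAt ℝ (⊤ : ℕ∞) (fun y => (M y).det) x := by
  simp only [Matrix.det_apply']
  exact ContDiffAt.sum fun σ _ => contDiffAt_const.mul (contDiffAt_prod fun i _ => hM _ _)

theorem ContDiffAt.cofU {f : E n → ℝ} {x : E n} (hf : ContDiffAt ℝ (⊤ : ℕ∞) f x) (i j : Fin n) :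
    ContDiffAt ℝ (⊤ : ℕ∞) (fun y => cofU f y i j) x := by
  simp only [_root_.cofU, Matrix.adjugate_apply]
  refine ContDiffAt.matrix_det fun k l => ?_
  by_cases hk : k = j
  · subst hk; simpa using contDiffAt_const
  · simpa [Matrix.updateRow_ne hk] using hf.hess k l

theorem ContDiffAt.two_of_top {f : E n → ℝ} {x : E n} (hf : ContDiffAt ℝ (⊤ : ℕ∞) f x) :
    ContDiffAt ℝ 2 f x :=
  hf.of_le (WithTop.coe_le_coe.2 (le_top : (2 : ℕ∞) ≤ ⊤))

theorem pd2_symm {f : E n → ℝ} {x : E n} (hf : ContDiffAt ℝ 2 f x) (i j : Fin n) :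
    pd2 f x i j = pd2 f x j i := by
  have hs : IsSymmSndFDerivAt ℝ f x := hf.isSymmSndFDerivAt (by simp)
  have hd : DifferentiableAt ℝ (fderiv ℝ f) x :=
    (hf.fderiv_right (m := 1) (by norm_num)).differentiableAt (by simp)
  have key : ∀ v w, fderiv ℝ (fun y => fderiv ℝ f y v) x w = fderiv ℝ (fderiv ℝ f) x w v := by
    intro v w
    rw [fderiv_clm_apply hd (differentiableAt_const v)]
    simp
  simp only [pd2, key]
  exact hs _ _

/-- The cofactor matrix of a nondegenerate Hessian is divergence free. -/
theorem sum_pd_cofU_eq_zero {u : E n → ℝ} {x : E n} (hu : ContDiffAt ℝ (⊤ : ℕ∞) u x)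
    (hdet : (Hess u x).det ≠ 0) (j : Fin n) :
    ∑ i, pd (fun y => cofU u y i j) x i = 0 := by
  have hTs1 : ∀ k i l, pd (fun y => Hess u y i l) x k = pd (fun y => Hess u y k l) x i :=
    fun k i l => pd2_symm (hu.pd l).two_of_top k i
  have hTs2 : ∀ k i l, pd (fun y => Hess u y i l) x k = pd (fun y => Hess u y l i) x k := by
    intro k i l
    have h : (fun y => Hess u y i l) =ᶠ[nhds x] fun y => Hess u y l i := by
      filter_upwards [hu.two_of_top.eventually (by simp)] with y hy
      exact pd2_symm hy i l
    simp only [pd, h.fderiv_eq]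
  have hdU : ∀ i l, DifferentiableAt ℝ (fun y => cofU u y i l) x :=
    fun i l => (hu.cofU i l).differentiableAt (by simp)
  have hdH : ∀ i l, DifferentiableAt ℝ (fun y => Hess u y i l) x :=
    fun i l => (hu.hess i l).differentiableAt (by simp)
  have hddet : DifferentiableAt ℝ (fun y => (Hess u y).det) x :=
    (ContDiffAt.matrix_det fun i l => hu.hess i l).differentiableAt (by simp)
  have jac : ∀ l, pd (fun y => (Hess u y).det) x l
      = ∑ i, ∑ k, cofU u x k i * pd (fun y => Hess u y i k) x l := by
    intro l
    refine pd_eq_of_hasDerivAt hddet ?_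
    have := hasDerivAt_matrix_det (t := 0)
      (M := fun s : ℝ => Hess u (x + s • EuclideanSpace.single l 1))
      (M' := Matrix.of fun i k => pd (fun y => Hess u y i k) x l)
      (fun i k => (hdH i k).hasDerivAt_coord_line l)
    simpa [cofU] using this
  have ident : ∀ i l, ∑ k, (pd (fun y => cofU u y i k) x i * Hess u x k l
      + cofU u x i k * pd (fun y => Hess u y k l) x i)
      = if i = l then pd (fun y => (Hess u y).det) x l else 0 := by
    intro i l
    have h1 : HasDerivAt (fun s : ℝ => ∑ k, cofU u (x + s • EuclideanSpace.single i 1) i k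
        * Hess u (x + s • EuclideanSpace.single i 1) k l)
        (∑ k, (pd (fun y => cofU u y i k) x i * Hess u x k l
      + cofU u x i k * pd (fun y => Hess u y k l) x i)) 0 := by
      refine HasDerivAt.fun_sum fun k _ => ?_
      simpa using ((hdU i k).hasDerivAt_coord_line i).fun_mul ((hdH k l).hasDerivAt_coord_line i)
    have h2 : ∀ y, ∑ k, cofU u y i k * Hess u y k l = if i = l then (Hess u y).det else 0 := by
      intro y
      have := congrFun (congrFun (Matrix.adjugate_mul (Hess u y)) i) l
      simpa [Matrix.mul_apply, Matrix.one_apply, cofU] using this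
    simp only [h2] at h1
    refine h1.unique ?_
    split_ifs with hil
    · subst hil; exact hddet.hasDerivAt_coord_line i
    · exact hasDerivAt_const _ _
  have hw : (fun k => ∑ i, pd (fun y => cofU u y i k) x i) = 0 := by
    refine Matrix.eq_zero_of_vecMul_eq_zero hdet ?_
    funext l
    have h := Finset.sum_congr rfl fun i (_ : i ∈ Finset.univ) => ident i l
    simp only [Finset.sum_ite_eq', Finset.mem_univ, if_true, jac, Finset.sum_add_distrib] at h
    have h3 : ∑ i, ∑ k, cofU u x i k * pd (fun y => Hess u y k l) x i
        = ∑ i, ∑ k, cofU u x k i * pd (fun y => Hess u y i k) x l := by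
      rw [Finset.sum_comm]
      refine Finset.sum_congr rfl fun k _ => Finset.sum_congr rfl fun i _ => ?_
      rw [hTs2 i k l, hTs1 i l k, hTs2 l i k]
    rw [h3] at h
    simp only [Matrix.vecMul, dotProduct, Pi.zero_apply, Finset.sum_mul]
    rw [Finset.sum_comm]
    linarith
  exact congrFun hw j

theorem integrableOn_of_continuousAt_of_eq_zero {V S : Set (E n)} (hV : IsOpen V)
    (hS : IsCompact (closure S)) (hSV : closure S ⊆ V) {F : E n → ℝ}
    (hF : ∀ x ∈ V, ContinuousAt F x) (h0 : ∀ x ∈ V \ closure S, F x = 0) : IntegrableOn F V := by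
  have h1 : IntegrableOn F (closure S) :=
    ContinuousOn.integrableOn_compact hS fun x hx => (hF x (hSV hx)).continuousWithinAt
  refine h1.of_forall_sdiff_eq_zero hV.measurableSet h0

/-- The divergence of a `C¹` vector field vanishing outside a relatively compact set has
vanishing integral. -/
theorem setIntegral_sum_pd_eq_zero {V S : Set (E n)} (hV : IsOpen V)
    (hS : IsCompact (closure S)) (hSV : closure S ⊆ V) {X : Fin n → E n → ℝ}
    (hX : ∀ i, ∀ x ∈ V, ContDiffAt ℝ 1 (X i) x) (h0 : ∀ i, ∀ x ∈ V \ S, X i x = 0) :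
    ∫ x in V, ∑ i, pd (X i) x i = 0 := by
  have hloc : ∀ i, ∀ x ∈ V, V.indicator (X i) =ᶠ[nhds x] X i := by
    intro i x hx
    filter_upwards [hV.mem_nhds hx] with y hy
    exact Set.indicator_of_mem hy _
  have hsupp : ∀ i, Function.support (V.indicator (X i)) ⊆ closure S := by
    intro i x hx
    by_contra hxS
    refine hx ?_
    by_cases hxV : x ∈ V
    · rw [Set.indicator_of_mem hxV]
      exact h0 i x ⟨hxV, fun h => hxS (subset_closure h)⟩
    · exact Set.indicator_of_notMem hxV _
  have hzero : ∀ i, ∀ x ∉ V, V.indicator (X i) =ᶠ[nhds x] fun _ => 0 := by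
    intro i x hx
    filter_upwards [isClosed_closure.isOpen_compl.mem_nhds fun h => hx (hSV h)] with y hy
    by_contra h
    exact hy (hsupp i h)
  have hC : ∀ i, ContDiff ℝ 1 (V.indicator (X i)) := by
    intro i
    rw [contDiff_iff_contDiffAt]
    intro x
    by_cases hx : x ∈ V
    · exact (hX i x hx).congr_of_eventuallyEq (hloc i x hx)
    · exact contDiffAt_const.congr_of_eventuallyEq (hzero i x hx)
  have hcs : ∀ i, HasCompactSupport (V.indicator (X i)) := fun i =>
    HasCompactSupport.of_support_subset_isCompact hS (hsupp i)
  have hpd : ∀ i x, pd (V.indicator (X i)) x i = V.indicator (fun y => pd (X i) y i) x := by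
    intro i x
    by_cases hx : x ∈ V
    · rw [Set.indicator_of_mem hx]
      simp only [pd, (hloc i x hx).fderiv_eq]
    · rw [Set.indicator_of_notMem hx]
      simp [pd, (hzero i x hx).fderiv_eq]
  have hcont : ∀ i, Continuous fun x => pd (V.indicator (X i)) x i := fun i =>
    ((hC i).continuous_fderiv (by simp)).clm_apply continuous_const
  have hInt : ∀ i, Integrable fun x => pd (V.indicator (X i)) x i := fun i =>
    (hcont i).integrable_of_hasCompactSupport ((hcs i).fderiv_apply ℝ _)
  have hi : ∀ i, ∫ x, pd (V.indicator (X i)) x i = 0 := by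
    intro i
    have := integral_mul_fderiv_eq_neg_fderiv_mul_of_integrable (μ := (volume : Measure (E n)))
      (f := fun _ => (1 : ℝ)) (g := V.indicator (X i)) (v := EuclideanSpace.single i 1)
      (by simp) (by simp only [one_mul]; exact hInt i)
      (by simpa using (hC i).continuous.integrable_of_hasCompactSupport (hcs i))
      (fun _ _ => differentiableAt_const _)
      (fun x _ => (hC i).differentiable (by simp) x)
    simpa [pd] using this
  rw [← integral_indicator hV.measurableSet]
  have : V.indicator (fun x => ∑ i, pd (X i) x i)
      = fun x => ∑ i, pd (V.indicator (X i)) x i := by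
    funext x
    simp only [hpd]
    by_cases hx : x ∈ V <;> simp [hx]
  rw [this, integral_finsetSum _ fun i _ => hInt i]
  simp [hi]

theorem cofU_symm {u : E n → ℝ} {x : E n} (hu : ContDiffAt ℝ 2 u x) (i j : Fin n) :
    cofU u x i j = cofU u x j i := by
  have : (Hess u x).IsSymm := Matrix.IsSymm.ext fun i j => pd2_symm hu j i
  exact this.adjugate.apply j i

/-- Since the cofactor matrix is divergence free, `∂ᵢ(U^{ij} Wⱼ) = U^{ij} ∂ᵢ Wⱼ`. -/
theorem sum_pd_cofU_mul {u : E n → ℝ} {x : E n} (hu : ContDiffAt ℝ (⊤ : ℕ∞) u x)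
    (hdet : (Hess u x).det ≠ 0) {W : Fin n → E n → ℝ}
    (hW : ∀ j, DifferentiableAt ℝ (W j) x) :
    ∑ i, pd (fun y => ∑ j, cofU u y i j * W j y) x i
      = ∑ i, ∑ j, cofU u x i j * pd (W j) x i := by
  have hU : ∀ i j, DifferentiableAt ℝ (fun y => cofU u y i j) x := fun i j =>
    (hu.cofU i j).differentiableAt (by simp)
  have h1 : ∀ i, pd (fun y => ∑ j, cofU u y i j * W j y) x i
      = ∑ j, (pd (fun y => cofU u y i j) x i * W j x + cofU u x i j * pd (W j) x i) := by
    intro i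
    refine pd_eq_of_hasDerivAt ?_ (HasDerivAt.fun_sum fun j _ => ?_)
    · exact DifferentiableAt.fun_sum fun j _ => (hU i j).mul (hW j)
    · simpa using ((hU i j).hasDerivAt_coord_line i).fun_mul ((hW j).hasDerivAt_coord_line i)
  simp only [h1, Finset.sum_add_distrib]
  rw [Finset.sum_comm]
  simp [← Finset.sum_mul, sum_pd_cofU_eq_zero hu hdet]

theorem hasDerivAt_sub_norm_sq_line (M : ℝ) (x : E n) (i : Fin n) :
    HasDerivAt (fun s : ℝ => M - ‖x + s • EuclideanSpace.single i (1 : ℝ)‖ ^ 2) (-2 * x i) 0 := by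
  have h : HasFDerivAt (fun y : E n => ‖y‖ ^ 2) (2 • innerSL ℝ x) x :=
    (hasStrictFDerivAt_norm_sq x).hasFDerivAt
  have h1 := (h.hasLineDerivAt (EuclideanSpace.single i 1)).const_sub M
  refine h1.congr_deriv ?_
  simp [EuclideanSpace.inner_single_right]

theorem hasDerivAt_coord_line (x : E n) (i j : Fin n) :
    HasDerivAt (fun s : ℝ => (x + s • EuclideanSpace.single i (1 : ℝ)) j)
      (if i = j then 1 else 0) 0 := by
  have h : ∀ s : ℝ, (x + s • EuclideanSpace.single i (1 : ℝ)) j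
      = x j + s * (if i = j then 1 else 0) := by
    intro s
    simp [eq_comm]
  simp only [h]
  simpa using ((hasDerivAt_id (0 : ℝ)).mul_const (if i = j then (1 : ℝ) else 0)).const_add (x j)

theorem sum_cofU_mul_hess {φ : E n → ℝ} {x : E n} (hφ : ContDiffAt ℝ 2 φ x) :
    ∑ i, ∑ j, cofU φ x i j * Hess φ x i j = n * (Hess φ x).det := by
  have h : ∀ i, ∑ j, cofU φ x i j * Hess φ x i j = (Hess φ x).det := by
    intro i
    have := congrFun (congrFun (Matrix.adjugate_mul (Hess φ x)) i) i
    simp only [Matrix.mul_apply, Matrix.smul_apply, Matrix.one_apply_eq, smul_eq_mul,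
      mul_one] at this
    rw [← this]
    exact Finset.sum_congr rfl fun j _ => congrArg _ (pd2_symm hφ i j)
  simp [h]

/-- The field `(h(φ)² / f) ∇f + K(φ) ∇φ` with `f = M - |x|²`. -/
def energyField (φ : E n → ℝ) (M : ℝ) (h K : ℝ → ℝ) (j : Fin n) (y : E n) : ℝ :=
  h (φ y) ^ 2 / (M - ‖y‖ ^ 2) * (-2 * y j) + K (φ y) * pd φ y j

theorem energyField_contDiffAt {φ : E n → ℝ} {x : E n} (hφ : ContDiffAt ℝ (⊤ : ℕ∞) φ x) {M : ℝ}
    (hM : ‖x‖ ^ 2 < M) {h K : ℝ → ℝ} (hh : ContDiffAt ℝ 1 h (φ x))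
    (hK : ContDiffAt ℝ 1 K (φ x)) (j : Fin n) :
    ContDiffAt ℝ 1 (energyField φ M h K j) x := by
  have hφ1 : ContDiffAt ℝ 1 φ x := hφ.of_le (by simp)
  have hp : ContDiffAt ℝ 1 (fun y => pd φ y j) x := (hφ.pd j).of_le (by simp)
  have hf : ContDiffAt ℝ 1 (fun y : E n => M - ‖y‖ ^ 2) x :=
    contDiffAt_const.sub (contDiff_norm_sq ℝ).contDiffAt
  have hc : ContDiffAt ℝ 1 (fun y : E n => y j) x :=
    (EuclideanSpace.proj (𝕜 := ℝ) j).contDiff.contDiffAt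
  exact ((((hh.comp x hφ1).pow 2).div hf (sub_pos.2 hM).ne').mul (contDiffAt_const.mul hc)).add
    ((hK.comp x hφ1).mul hp)

theorem sum_cofU_mul_pd_energyField_le {φ : E n → ℝ} {x : E n}
    (hφ : ContDiffAt ℝ (⊤ : ℕ∞) φ x)
    (hU : ∀ ξ : Fin n → ℝ, 0 ≤ ∑ i, ∑ j, cofU φ x i j * (ξ i * ξ j)) {M : ℝ}
    (hM : ‖x‖ ^ 2 < M) {h K : ℝ → ℝ} (hh : ContDiffAt ℝ 1 h (φ x))
    (hK : ContDiffAt ℝ 1 K (φ x)) (hKh : deriv K (φ x) ≤ -(deriv h (φ x)) ^ 2) :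
    ∑ i, ∑ j, cofU φ x i j * pd (energyField φ M h K j) x i
      ≤ n * (K (φ x) * (Hess φ x).det)
        - 2 * (h (φ x) ^ 2 * (cofU φ x).trace / (M - ‖x‖ ^ 2)) := by
  set f := M - ‖x‖ ^ 2 with hfdef
  have hf : f ≠ 0 := (sub_pos.2 hM).ne'
  have hdφ : DifferentiableAt ℝ φ x := hφ.differentiableAt (by simp)
  set h0 := h (φ x)
  set h1 := deriv h (φ x)
  set K0 := K (φ x)
  set K1 := deriv K (φ x)
  have hpd : ∀ i j, pd (energyField φ M h K j) x i
      = ((2 * h0 * (h1 * pd φ x i)) * f - h0 ^ 2 * (-2 * x i)) / f ^ 2 * (-2 * x j)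
        + h0 ^ 2 / f * (-2 * (if i = j then 1 else 0))
        + (K1 * pd φ x i * pd φ x j + K0 * Hess φ x i j) := by
    intro i j
    refine pd_eq_of_hasDerivAt
      ((energyField_contDiffAt hφ hM hh hK j).differentiableAt (by simp)) ?_
    have e0 : x + (0 : ℝ) • EuclideanSpace.single i (1 : ℝ) = x := by simp
    have dφ := hdφ.hasDerivAt_coord_line i
    have dh : HasDerivAt (fun s : ℝ => h (φ (x + s • EuclideanSpace.single i 1)))
        (h1 * pd φ x i) 0 := by
      refine HasDerivAt.comp (0 : ℝ) (h₂ := h) ?_ dφ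
      rw [e0]
      exact (hh.differentiableAt (by simp)).hasDerivAt
    have dK : HasDerivAt (fun s : ℝ => K (φ (x + s • EuclideanSpace.single i 1)))
        (K1 * pd φ x i) 0 := by
      refine HasDerivAt.comp (0 : ℝ) (h₂ := K) ?_ dφ
      rw [e0]
      exact (hK.differentiableAt (by simp)).hasDerivAt
    have dp := ((hφ.pd j).differentiableAt (by simp)).hasDerivAt_coord_line i
    have df := hasDerivAt_sub_norm_sq_line M x i
    have dc := hasDerivAt_coord_line x i j
    have := (((dh.fun_pow 2).fun_div df (by rw [e0]; exact hf)).fun_mul (dc.const_mul (-2))).fun_add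
      (dK.fun_mul dp)
    refine this.congr_deriv ?_
    simp only [e0, ← hfdef]
    simp only [Hess, pd2, pd, Matrix.of_apply, h0, h1, K0, K1]
    norm_num
  have hsym : ∑ i, ∑ j, cofU φ x i j * (pd φ x i * x j)
      = ∑ i, ∑ j, cofU φ x i j * (x i * pd φ x j) := by
    rw [Finset.sum_comm]
    refine Finset.sum_congr rfl fun i _ => Finset.sum_congr rfl fun j _ => ?_
    rw [cofU_symm hφ.two_of_top]; ring
  have htr : ∑ i, ∑ j, cofU φ x i j * (if i = j then (1 : ℝ) else 0) = (cofU φ x).trace := by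
    simp [Matrix.trace]
  have hdet := sum_cofU_mul_hess hφ.two_of_top
  have q1 := hU fun i => h1 * pd φ x i + 2 * h0 / f * x i
  have q2 := hU fun i => pd φ x i
  have e1 : ∑ i, ∑ j, cofU φ x i j * ((h1 * pd φ x i + 2 * h0 / f * x i)
        * (h1 * pd φ x j + 2 * h0 / f * x j))
      = h1 ^ 2 * ∑ i, ∑ j, cofU φ x i j * (pd φ x i * pd φ x j)
        + 2 * h0 * h1 / f * ∑ i, ∑ j, cofU φ x i j * (pd φ x i * x j)
        + 2 * h0 * h1 / f * ∑ i, ∑ j, cofU φ x i j * (x i * pd φ x j)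
        + 4 * h0 ^ 2 / f ^ 2 * ∑ i, ∑ j, cofU φ x i j * (x i * x j) := by
    simp only [Finset.mul_sum, ← Finset.sum_add_distrib]
    refine Finset.sum_congr rfl fun i _ => Finset.sum_congr rfl fun j _ => ?_
    field_simp
    ring
  have e2 : ∑ i, ∑ j, cofU φ x i j * pd (energyField φ M h K j) x i
      = K1 * ∑ i, ∑ j, cofU φ x i j * (pd φ x i * pd φ x j)
        - 4 * h0 * h1 / f * ∑ i, ∑ j, cofU φ x i j * (pd φ x i * x j)
        - 4 * h0 ^ 2 / f ^ 2 * ∑ i, ∑ j, cofU φ x i j * (x i * x j)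
        - 2 * h0 ^ 2 / f * ∑ i, ∑ j, cofU φ x i j * (if i = j then (1 : ℝ) else 0)
        + K0 * ∑ i, ∑ j, cofU φ x i j * Hess φ x i j := by
    simp only [hpd, Finset.mul_sum, ← Finset.sum_add_distrib, ← Finset.sum_sub_distrib]
    refine Finset.sum_congr rfl fun i _ => Finset.sum_congr rfl fun j _ => ?_
    field_simp
    ring
  rw [e2, htr, hdet]
  rw [e1, ← hsym] at q1
  have q3 := mul_nonneg (by linarith : 0 ≤ -h1 ^ 2 - K1) q2
  have e3 : 2 * (h0 ^ 2 * (cofU φ x).trace / f) = 2 * h0 ^ 2 / f * (cofU φ x).trace := by ring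
  have e4 : 4 * h0 * h1 / f = 2 * (2 * h0 * h1 / f) := by ring
  rw [e3, e4]
  nlinarith

theorem energy_inequality {V S : Set (E n)} (hV : IsOpen V)
    (hS : IsCompact (closure S)) (hSV : closure S ⊆ V) {φ : E n → ℝ}
    (hφ : ∀ x ∈ V, ContDiffAt ℝ (⊤ : ℕ∞) φ x) (hdet : ∀ x ∈ V, (Hess φ x).det ≠ 0)
    (hU : ∀ x ∈ V, ∀ ξ : Fin n → ℝ, 0 ≤ ∑ i, ∑ j, cofU φ x i j * (ξ i * ξ j)) {M : ℝ}
    (hM : ∀ x ∈ V, ‖x‖ ^ 2 < M) {h K : ℝ → ℝ} (hh : ∀ x ∈ V, ContDiffAt ℝ 1 h (φ x))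
    (hK : ∀ x ∈ V, ContDiffAt ℝ 1 K (φ x))
    (hKh : ∀ x ∈ V, deriv K (φ x) ≤ -(deriv h (φ x)) ^ 2)
    (hh0 : ∀ x ∈ V \ S, h (φ x) = 0) (hK0 : ∀ x ∈ V \ S, K (φ x) = 0) :
    2 * ∫ x in V, h (φ x) ^ 2 * (cofU φ x).trace / (M - ‖x‖ ^ 2)
      ≤ n * ∫ x in V, K (φ x) * (Hess φ x).det := by
  have hW : ∀ j, ∀ x ∈ V, ContDiffAt ℝ 1 (energyField φ M h K j) x := fun j x hx =>
    energyField_contDiffAt (hφ x hx) (hM x hx) (hh x hx) (hK x hx) j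
  set X : Fin n → E n → ℝ := fun i y => ∑ j, cofU φ y i j * energyField φ M h K j y with hX
  have hXC : ∀ i, ∀ x ∈ V, ContDiffAt ℝ 1 (X i) x := fun i x hx =>
    ContDiffAt.sum fun j _ => (((hφ x hx).cofU i j).of_le (by simp)).mul (hW j x hx)
  have hX0 : ∀ i, ∀ x ∈ V \ S, X i x = 0 := by
    intro i x hx
    simp [hX, energyField, hh0 x hx, hK0 x hx]
  have hdiv := setIntegral_sum_pd_eq_zero hV hS hSV hXC hX0
  have hcφ : ∀ x ∈ V, ContinuousAt φ x := fun x hx => (hφ x hx).continuousAt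
  have i1 : IntegrableOn (fun x => h (φ x) ^ 2 * (cofU φ x).trace / (M - ‖x‖ ^ 2)) V := by
    refine integrableOn_of_continuousAt_of_eq_zero hV hS hSV (fun x hx => ?_) fun x hx => ?_
    · have c1 : ContinuousAt (fun x => (cofU φ x).trace) x := by
        simp only [Matrix.trace, Matrix.diag]
        exact tendsto_finsetSum _ fun i _ => ((hφ x hx).cofU i i).continuousAt
      have c2 : ContinuousAt (fun x => h (φ x)) x :=
        ContinuousAt.comp (hh x hx).continuousAt (hcφ x hx)
      exact ((c2.pow 2).mul c1).div (by fun_prop) (sub_pos.2 (hM x hx)).ne'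
    · simp [hh0 x ⟨hx.1, fun h => hx.2 (subset_closure h)⟩]
  have i2 : IntegrableOn (fun x => K (φ x) * (Hess φ x).det) V := by
    refine integrableOn_of_continuousAt_of_eq_zero hV hS hSV (fun x hx => ?_) fun x hx => ?_
    · have c1 : ContinuousAt (fun x => (Hess φ x).det) x :=
        (ContDiffAt.matrix_det fun i j => (hφ x hx).hess i j).continuousAt
      have c2 : ContinuousAt (fun x => K (φ x)) x :=
        ContinuousAt.comp (hK x hx).continuousAt (hcφ x hx)
      exact c2.mul c1
    · simp [hK0 x ⟨hx.1, fun h => hx.2 (subset_closure h)⟩]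
  have hle : ∫ x in V, ∑ i, pd (X i) x i
      ≤ ∫ x in V, (n * (K (φ x) * (Hess φ x).det)
        - 2 * (h (φ x) ^ 2 * (cofU φ x).trace / (M - ‖x‖ ^ 2))) := by
    refine setIntegral_mono_on ?_ ((i2.const_mul _).sub (i1.const_mul _)) hV.measurableSet ?_
    · refine integrableOn_of_continuousAt_of_eq_zero hV hS hSV (fun x hx => ?_) fun x hx => ?_
      · refine tendsto_finsetSum _ fun i _ => ?_
        exact (((hXC i x hx).fderiv_right (m := 0) (by simp)).clm_apply
          contDiffAt_const).continuousAt
      · refine Finset.sum_eq_zero fun i _ => ?_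
        have : X i =ᶠ[nhds x] fun _ => 0 := by
          filter_upwards [(hV.sdiff isClosed_closure).mem_nhds hx] with y hy
          exact hX0 i y ⟨hy.1, fun h => hy.2 (subset_closure h)⟩
        simp [pd, this.fderiv_eq]
    · intro x hx
      rw [sum_pd_cofU_mul (hφ x hx) (hdet x hx) fun j => (hW j x hx).differentiableAt (by simp)]
      exact sum_cofU_mul_pd_energyField_le (hφ x hx) (hU x hx) (hM x hx) (hh x hx) (hK x hx)
        (hKh x hx)
  rw [hdiv, integral_sub (i2.const_mul _) (i1.const_mul _), integral_const_mul,
    integral_const_mul] at hle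
  linarith

theorem ConvexOn.comp_line {D : Set (E n)} {φ : E n → ℝ} (hφ : ConvexOn ℝ D φ) (x w : E n) :
    ConvexOn ℝ {s : ℝ | x + s • w ∈ D} (fun s : ℝ => φ (x + s • w)) := by
  have h := hφ.comp_affineMap (AffineMap.lineMap x (x + w) : ℝ →ᵃ[ℝ] E n)
  have h1 : ∀ s : ℝ, AffineMap.lineMap x (x + w) s = x + s • w := by
    intro s; simp [AffineMap.lineMap_apply, add_comm]
  simpa [Function.comp_def, Set.preimage, h1] using h

theorem hasDerivAt_comp_line {φ : E n → ℝ} {x w : E n} {s : ℝ}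
    (hφ : DifferentiableAt ℝ φ (x + s • w)) :
    HasDerivAt (fun s : ℝ => φ (x + s • w)) (fderiv ℝ φ (x + s • w) w) s := by
  have h1 : HasDerivAt (fun s : ℝ => x + s • w) w s := by
    simpa using ((hasDerivAt_id s).smul_const w).const_add x
  exact hφ.hasFDerivAt.comp_hasDerivAt s h1

/-- A convex function lies above its tangent planes. -/
theorem ConvexOn.add_fderiv_le {D : Set (E n)} {φ : E n → ℝ} (hφ : ConvexOn ℝ D φ) {x y : E n}
    (hx : x ∈ D) (hy : y ∈ D) (hd : DifferentiableAt ℝ φ x) :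
    φ x + fderiv ℝ φ x (y - x) ≤ φ y := by
  have h := (hφ.comp_line x (y - x)).le_slope_of_hasDerivAt (x := 0) (y := 1)
    (by simpa using hx) (by simpa using hy) one_pos (hasDerivAt_comp_line (by simpa using hd))
  simp only [slope_def_field, zero_smul, add_zero, one_smul, add_sub_cancel, sub_zero, div_one] at h
  linarith

theorem fderiv_eq_sum_pd (f : E n → ℝ) (x w : E n) :
    fderiv ℝ f x w = ∑ i, w i * pd f x i := by
  conv_lhs => rw [← (EuclideanSpace.basisFun (Fin n) ℝ).sum_repr w]
  simp [pd, map_sum]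

theorem hasDerivAt_fderiv_comp_line {φ : E n → ℝ} {x w : E n} {s : ℝ}
    (hφ : ContDiffAt ℝ (⊤ : ℕ∞) φ (x + s • w)) :
    HasDerivAt (fun s : ℝ => fderiv ℝ φ (x + s • w) w)
      (w.ofLp ⬝ᵥ (Hess φ (x + s • w)).mulVec w.ofLp) s := by
  have h : ∀ y, fderiv ℝ φ y w = ∑ i, w i * pd φ y i := fun y => fderiv_eq_sum_pd φ y w
  simp only [h]
  have h2 : ∀ i, HasDerivAt (fun s : ℝ => w i * pd φ (x + s • w) i)
      (w i * ∑ j, w j * pd (fun y => pd φ y i) (x + s • w) j) s := by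
    intro i
    rw [← fderiv_eq_sum_pd]
    exact (hasDerivAt_comp_line ((hφ.pd i).differentiableAt (by simp))).const_mul _
  refine (HasDerivAt.fun_sum fun i _ => h2 i).congr_deriv ?_
  simp only [dotProduct, Matrix.mulVec]
  refine Finset.sum_congr rfl fun i _ => congrArg _ (Finset.sum_congr rfl fun j _ => ?_)
  rw [mul_comm]
  congr 1
  exact pd2_symm hφ.two_of_top j i

theorem ConvexOn.hess_posSemidef {W : Set (E n)} (hW : IsOpen W) {φ : E n → ℝ}
    (hφ : ConvexOn ℝ W φ) (hs : ∀ x ∈ W, ContDiffAt ℝ (⊤ : ℕ∞) φ x) {x : E n} (hx : x ∈ W) :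
    (Hess φ x).PosSemidef := by
  refine Matrix.PosSemidef.of_dotProduct_mulVec_nonneg ?_ fun v => ?_
  · ext i j
    exact pd2_symm (hs x hx).two_of_top j i
  set w : E n := WithLp.toLp 2 v
  set T : Set ℝ := {s : ℝ | x + s • w ∈ W}
  have hT : IsOpen T := hW.preimage (by fun_prop)
  have h0 : (0 : ℝ) ∈ T := by simpa [T] using hx
  have hd : ∀ s ∈ T, HasDerivAt (fun s : ℝ => φ (x + s • w)) (fderiv ℝ φ (x + s • w) w) s :=
    fun s hs' => hasDerivAt_comp_line ((hs _ hs').differentiableAt (by simp))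
  have hm : MonotoneOn (fun s : ℝ => fderiv ℝ φ (x + s • w) w) T := by
    refine ((hφ.comp_line x w).monotoneOn_deriv fun s hs' => (hd s hs').differentiableAt).congr ?_
    exact fun s hs' => (hd s hs').deriv
  have h2 := hasDerivAt_fderiv_comp_line (w := w) (s := 0) (by simpa using hs x hx)
  have h3 := hm.derivWithin_nonneg (x := 0)
  rw [derivWithin_of_isOpen hT h0, h2.deriv] at h3
  simpa [w] using h3

theorem ConvexOn.hess_posDef {W : Set (E n)} (hW : IsOpen W) {φ : E n → ℝ}
    (hφ : ConvexOn ℝ W φ) (hs : ∀ x ∈ W, ContDiffAt ℝ (⊤ : ℕ∞) φ x)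
    (hdet : ∀ x ∈ W, (Hess φ x).det ≠ 0) {x : E n} (hx : x ∈ W) :
    (Hess φ x).PosDef :=
  (hφ.hess_posSemidef hW hs hx).posDef_iff_det_ne_zero.2 (hdet x hx)

theorem Matrix.PosDef.adjugate {A : Matrix (Fin n) (Fin n) ℝ} (hA : A.PosDef) :
    A.adjugate.PosDef := by
  have h : A.adjugate = A.det • A⁻¹ := by
    rw [Matrix.inv_def, smul_smul, Ring.mul_inverse_cancel _ hA.det_pos.ne'.isUnit, one_smul]
  rw [h]
  exact hA.inv.smul hA.det_pos

/-- The gradient as a self-map of Euclidean space. -/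
def gradMap (φ : E n → ℝ) (x : E n) : E n := WithLp.toLp 2 fun i => pd φ x i

theorem hasFDerivAt_gradMap {φ : E n → ℝ} {x : E n} (hφ : ContDiffAt ℝ (⊤ : ℕ∞) φ x) :
    HasFDerivAt (gradMap φ)
      (LinearMap.toContinuousLinearMap (Matrix.toEuclideanLin (Hess φ x))) x := by
  rw [← hasFDerivWithinAt_univ, hasFDerivWithinAt_euclidean]
  intro i
  rw [hasFDerivWithinAt_univ]
  have h := ((hφ.pd i).differentiableAt (by simp)).hasFDerivAt
  refine h.congr_fderiv ?_
  ext w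
  rw [fderiv_eq_sum_pd]
  change _ = ∑ j, Hess φ x i j * w j
  refine Finset.sum_congr rfl fun j _ => ?_
  rw [mul_comm]
  congr 1
  exact pd2_symm hφ.two_of_top j i

theorem det_toContinuousLinearMap_toEuclideanLin (A : Matrix (Fin n) (Fin n) ℝ) :
    (LinearMap.toContinuousLinearMap (Matrix.toEuclideanLin A)).det = A.det := by
  rw [ContinuousLinearMap.det]
  exact LinearMap.det_toLpLin 2 A

theorem inner_gradMap (φ : E n → ℝ) (x w : E n) : inner ℝ (gradMap φ x) w = fderiv ℝ φ x w := by
  rw [fderiv_eq_sum_pd]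
  simp [gradMap, PiLp.inner_apply]

theorem injOn_gradMap {W : Set (E n)} (hWc : Convex ℝ W) {φ : E n → ℝ}
    (hs : ∀ x ∈ W, ContDiffAt ℝ (⊤ : ℕ∞) φ x) (hpos : ∀ x ∈ W, (Hess φ x).PosDef) :
    Set.InjOn (gradMap φ) W := by
  intro x hx y hy hxy
  by_contra hne
  set w : E n := y - x
  have hw : w.ofLp ≠ 0 := by
    intro h
    apply hne
    have : w = 0 := by ext i; simpa using congrFun h i
    exact (sub_eq_zero.1 this).symm
  have hmem : ∀ s ∈ Set.Icc (0 : ℝ) 1, x + s • w ∈ W := fun s hs' =>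
    hWc.add_smul_sub_mem hx hy hs'
  have hd : ∀ s ∈ Set.Icc (0 : ℝ) 1, HasDerivAt (fun s : ℝ => fderiv ℝ φ (x + s • w) w)
      (w.ofLp ⬝ᵥ (Hess φ (x + s • w)).mulVec w.ofLp) s := fun s hs' =>
    hasDerivAt_fderiv_comp_line (hs _ (hmem s hs'))
  have hm : StrictMonoOn (fun s : ℝ => fderiv ℝ φ (x + s • w) w) (Set.Icc 0 1) := by
    refine strictMonoOn_of_deriv_pos (convex_Icc 0 1)
      (fun s hs' => (hd s hs').continuousAt.continuousWithinAt) fun s hs' => ?_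
    have hs'' := interior_subset hs'
    rw [(hd s hs'').deriv]
    simpa using (hpos _ (hmem s hs'')).dotProduct_mulVec_pos hw
  have h := hm (a := 0) (b := 1) (by simp) (by simp) one_pos
  simp only [zero_smul, add_zero, one_smul, w, add_sub_cancel] at h
  rw [← inner_gradMap, ← inner_gradMap, hxy] at h
  exact lt_irrefl _ h

theorem volume_box (l r : Fin n → ℝ) :
    volume {p : E n | ∀ i, p i ∈ Set.Icc (l i) (r i)} = ∏ i, ENNReal.ofReal (r i - l i) := by
  have h : {p : E n | ∀ i, p i ∈ Set.Icc (l i) (r i)}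
      = WithLp.ofLp ⁻¹' (Set.Icc l r) := by
    ext p
    simp [Pi.le_def, forall_and]
  rw [h, (PiLp.volume_preserving_ofLp (Fin n)).measure_preimage measurableSet_Icc.nullMeasurableSet,
    Real.volume_Icc_pi]

theorem mem_of_sum_le_one {K : Set (E n)} (hK : Convex ℝ K) {x₀ : E n} (hx₀ : x₀ ∈ K)
    {A : Matrix (Fin n) (Fin n) ℝ} (hA : ∀ j, x₀ + WithLp.toLp 2 (A.col j) ∈ K) {b : E n}
    (hb : ∀ i, 0 ≤ b i) (hb1 : ∑ i, b i ≤ 1) : x₀ + Matrix.toEuclideanLin A b ∈ K := by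
  have h := hK.sum_mem (t := (Finset.univ : Finset (Option (Fin n))))
    (w := fun o => o.elim (1 - ∑ i, b i) b)
    (z := fun o => o.elim x₀ fun j => x₀ + WithLp.toLp 2 (A.col j))
    (fun o _ => by cases o <;> simp [hb, hb1]) (by simp) (fun o _ => by cases o <;> simp [hA, hx₀])
  convert h
  simp only [Fintype.sum_option, Option.elim_none, Option.elim_some, smul_add,
    Finset.sum_add_distrib, ← Finset.sum_smul]
  rw [← add_assoc, ← add_smul, sub_add_cancel, one_smul]
  congr 1
  ext i
  simp [Matrix.toLpLin_apply, Matrix.mulVec, dotProduct, mul_comm, Matrix.col_apply]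

/-- Vectors of a compact set spanning a parallelepiped of maximal volume. -/
theorem exists_maximal_frame {K : Set (E n)} (hK : IsCompact K) {x₀ : E n}
    (hx₀ : x₀ ∈ interior K) :
    ∃ A : Matrix (Fin n) (Fin n) ℝ, A.det ≠ 0 ∧ (∀ j, x₀ + WithLp.toLp 2 (A.col j) ∈ K) ∧
      ∀ x ∈ K, ∃ a : E n, (∀ i, |a i| ≤ 1) ∧ x = x₀ + Matrix.toEuclideanLin A a := by
  set T : Set (Fin n → E n) := Set.univ.pi fun _ => K
  have hT : IsCompact T := isCompact_univ_pi fun _ => hK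
  set F : (Fin n → E n) → Matrix (Fin n) (Fin n) ℝ := fun v => Matrix.of fun i j => (v j - x₀) i
  have hF : Continuous fun v => |(F v).det| := by
    refine (Continuous.matrix_det ?_).abs
    refine continuous_matrix fun i j => ?_
    change Continuous fun v : Fin n → E n => (v j - x₀) i
    fun_prop
  obtain ⟨v, hvT, hv⟩ := hT.exists_isMaxOn ⟨fun _ => x₀, fun i _ => interior_subset hx₀⟩
    hF.continuousOn
  have hcol : ∀ j, x₀ + WithLp.toLp 2 ((F v).col j) = v j := by
    intro j; ext i; simp [F, Matrix.col_apply]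
  have hdet : (F v).det ≠ 0 := by
    obtain ⟨r, hr, hrK⟩ := Metric.isOpen_iff.1 isOpen_interior x₀ hx₀
    have h1 : (fun j => x₀ + EuclideanSpace.single j (r / 2)) ∈ T := by
      intro j _
      apply interior_subset
      apply hrK
      simp [abs_of_pos hr, hr]
    have h2 := hv h1
    have h3 : F (fun j => x₀ + EuclideanSpace.single j (r / 2))
        = (r / 2) • (1 : Matrix (Fin n) (Fin n) ℝ) := by
      ext i j
      simp [F, Matrix.one_apply]
    have h4 : 0 < |((r / 2) • (1 : Matrix (Fin n) (Fin n) ℝ)).det| := by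
      rw [Matrix.det_smul]; simp; positivity
    simp only [Set.mem_ofPred_eq, h3] at h2
    exact abs_pos.1 (h4.trans_le h2)
  refine ⟨F v, hdet, fun j => by rw [hcol]; exact hvT j trivial, fun x hx => ?_⟩
  have hu : IsUnit (F v).det := hdet.isUnit
  refine ⟨WithLp.toLp 2 ((F v)⁻¹.mulVec (x - x₀).ofLp), fun i => ?_, ?_⟩
  · have h1 : Function.update v i x ∈ T := by
      intro j _
      by_cases h : j = i
      · subst h; simpa using hx
      · simpa [h] using hvT j trivial
    have h2 := hv h1
    have h3 : F (Function.update v i x) = (F v).updateCol i (x - x₀).ofLp := by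
      ext k j
      by_cases h : j = i
      · subst h; simp [F]
      · simp [F, h]
    simp only [Set.mem_ofPred_eq, h3] at h2
    have h5 : (F v).det * (F v)⁻¹.mulVec (x - x₀).ofLp i
        = ((F v).updateCol i (x - x₀).ofLp).det := by
      rw [← Matrix.cramer_apply, Matrix.cramer_eq_adjugate_mulVec, Matrix.inv_def,
        Matrix.smul_mulVec, Pi.smul_apply, smul_eq_mul, ← mul_assoc,
        Ring.mul_inverse_cancel _ hu, one_mul]
    rw [← h5, abs_mul] at h2
    exact le_of_mul_le_mul_left (by simpa using h2) (abs_pos.2 hdet)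
  · rw [Matrix.toLpLin_toLp]
    simp [Matrix.mul_nonsing_inv _ hu]

theorem volume_le_of_frame {K : Set (E n)} {x₀ : E n} {A : Matrix (Fin n) (Fin n) ℝ}
    (hA : ∀ x ∈ K, ∃ a : E n, (∀ i, |a i| ≤ 1) ∧ x = x₀ + Matrix.toEuclideanLin A a) :
    volume K ≤ ENNReal.ofReal (2 ^ n * |A.det|) := by
  have h : K ⊆ (fun y => x₀ + y) '' (Matrix.toEuclideanLin A ''
      {p : E n | ∀ i, p i ∈ Set.Icc (-1 : ℝ) 1}) := by
    intro x hx
    obtain ⟨a, ha, rfl⟩ := hA x hx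
    exact ⟨_, ⟨a, fun i => abs_le.1 (ha i), rfl⟩, rfl⟩
  refine (measure_mono h).trans ?_
  rw [Set.image_add_left, measure_preimage_add, Measure.addHaar_image_linearMap, LinearMap.det_toLpLin,
    volume_box (fun _ => -1) (fun _ => 1)]
  rw [Finset.prod_const, Finset.card_univ, Fintype.card_fin, ← ENNReal.ofReal_pow (by norm_num),
    ← ENNReal.ofReal_mul (abs_nonneg _)]
  norm_num [mul_comm]

theorem inner_toEuclideanLin (A : Matrix (Fin n) (Fin n) ℝ) (p a : E n) :
    inner ℝ p (Matrix.toEuclideanLin A a) = inner ℝ (Matrix.toEuclideanLin A.transpose p) a := by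
  simp only [PiLp.inner_apply, Matrix.toLpLin_apply, Matrix.mulVec, dotProduct,
    RCLike.inner_apply, conj_trivial, Matrix.transpose_apply, Finset.sum_mul, Finset.mul_sum]
  rw [Finset.sum_comm]
  exact Finset.sum_congr rfl fun i _ => Finset.sum_congr rfl fun j _ => by ring

/-- A bounded open convex sublevel set `{φ < σ}` of a convex function with minimum value `0` at
`x₀`, which is smooth with Hessian determinant pinched between `lam` and `Lam`. -/
structure IsConvexSublevel (S : Set (E n)) (x₀ : E n) (φ : E n → ℝ) (σ lam Lam : ℝ) : Prop where
  isOpen : IsOpen S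
  convex : Convex ℝ S
  isCompact : IsCompact (closure S)
  mem : x₀ ∈ S
  smooth : ∀ x ∈ S, ContDiffAt ℝ (⊤ : ℕ∞) φ x
  continuousOn : ContinuousOn φ (closure S)
  convexOn : ConvexOn ℝ (closure S) φ
  eq_zero : φ x₀ = 0
  nonneg : ∀ x ∈ closure S, 0 ≤ φ x
  le : ∀ x ∈ closure S, φ x ≤ σ
  ge : ∀ x ∈ closure S \ S, σ ≤ φ x
  det_ge : ∀ x ∈ S, lam ≤ (Hess φ x).det
  det_le : ∀ x ∈ S, (Hess φ x).det ≤ Lam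

namespace IsConvexSublevel

variable {S : Set (E n)} {x₀ : E n} {φ : E n → ℝ} {σ lam Lam : ℝ}

theorem hess_posDef (h : IsConvexSublevel S x₀ φ σ lam Lam) (hlam : 0 < lam) {x : E n}
    (hx : x ∈ S) : (Hess φ x).PosDef :=
  (h.convexOn.subset subset_closure h.convex).hess_posDef h.isOpen h.smooth
    (fun y hy => (hlam.trans_le (h.det_ge y hy)).ne') hx

theorem mul_volume_le_volume_image (h : IsConvexSublevel S x₀ φ σ lam Lam) (hlam : 0 < lam)
    {Q : Set (E n)} (hQ : MeasurableSet Q) (hQS : Q ⊆ S) :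
    ENNReal.ofReal lam * volume Q ≤ volume (gradMap φ '' Q) := by
  rw [← lintegral_abs_det_fderiv_eq_addHaar_image volume hQ
    (fun x hx => (hasFDerivAt_gradMap (h.smooth x (hQS hx))).hasFDerivWithinAt)
    ((injOn_gradMap h.convex h.smooth fun x hx => h.hess_posDef hlam hx).mono hQS),
    ← setLIntegral_const]
  refine setLIntegral_mono' hQ fun x hx => ?_
  rw [det_toContinuousLinearMap_toEuclideanLin]
  exact ENNReal.ofReal_le_ofReal ((h.det_ge x (hQS hx)).trans (le_abs_self _))

theorem volume_image_le_mul_volume (h : IsConvexSublevel S x₀ φ σ lam Lam) (hlam : 0 < lam) :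
    volume (gradMap φ '' S) ≤ ENNReal.ofReal Lam * volume S := by
  refine (addHaar_image_le_lintegral_abs_det_fderiv volume h.isOpen.measurableSet
    (fun x hx => (hasFDerivAt_gradMap (h.smooth x hx)).hasFDerivWithinAt)).trans ?_
  rw [← setLIntegral_const]
  refine setLIntegral_mono' h.isOpen.measurableSet fun x hx => ?_
  rw [det_toContinuousLinearMap_toEuclideanLin]
  refine ENNReal.ofReal_le_ofReal ?_
  rw [abs_of_pos (hlam.trans_le (h.det_ge x hx))]
  exact h.det_le x hx

theorem det_sq_le (h : IsConvexSublevel S x₀ φ σ lam Lam) (hn : 1 ≤ n) (hlam : 0 < lam)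
    (hσ : 0 < σ) {A : Matrix (Fin n) (Fin n) ℝ} (hdet : A.det ≠ 0)
    (hA : ∀ j, x₀ + WithLp.toLp 2 (A.col j) ∈ closure S) :
    A.det ^ 2 ≤ (18 * n ^ 2) ^ n * σ ^ n / lam := by
  have hn0 : (0 : ℝ) < n := by exact_mod_cast hn
  set δ : ℝ := 1 / (3 * n) with hδ
  have hδ0 : 0 < δ := by positivity
  have hδn : n * δ = 1 / 3 := by rw [hδ]; field_simp
  set B : Set (E n) := {p : E n | ∀ i, p i ∈ Set.Icc δ (2 * δ)}
  set Q : Set (E n) := (fun y => x₀ + y) '' (Matrix.toEuclideanLin A '' B)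
  have hKc : Convex ℝ (closure S) := h.convex.closure
  have hx₀ : x₀ ∈ closure S := subset_closure h.mem
  have hBc : IsCompact B := by
    have : B = WithLp.ofLp ⁻¹' (Set.Icc (fun _ : Fin n => δ) (fun _ => 2 * δ)) := by
      ext p; simp [B, Pi.le_def, forall_and]
    rw [this]
    exact (PiLp.homeomorph 2 (fun _ : Fin n => ℝ)).isCompact_preimage.2 isCompact_Icc
  have hQc : IsCompact Q := (hBc.image (LinearMap.continuous_of_finiteDimensional _)).image
    (by fun_prop)
  have hsum : ∀ b ∈ B, ∑ i, b i ≤ 2 / 3 := by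
    intro b hb
    calc ∑ i, b i ≤ ∑ _i : Fin n, 2 * δ := Finset.sum_le_sum fun i _ => (hb i).2
      _ = 2 / 3 := by simp; linarith
  have hQS : Q ⊆ S := by
    rintro _ ⟨_, ⟨b, hb, rfl⟩, rfl⟩
    have h1 := mem_of_sum_le_one hKc hx₀ hA (b := (3 / 2 : ℝ) • b)
      (fun i => by simp; linarith [(hb i).1]) (by
        simp only [PiLp.smul_apply, smul_eq_mul, ← Finset.mul_sum]; linarith [hsum b hb])
    have h2 := h.convex.combo_interior_closure_mem_interior (h.isOpen.interior_eq.symm ▸ h.mem) h1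
      (a := 1 / 3) (b := 2 / 3) (by norm_num) (by norm_num) (by norm_num)
    rw [h.isOpen.interior_eq] at h2
    convert h2 using 1
    rw [map_smul, smul_add, smul_smul, ← add_assoc, ← add_smul]
    norm_num
  have hgrad : gradMap φ '' Q ⊆ Matrix.toEuclideanLin A.transpose ⁻¹'
      {p : E n | ∀ i, p i ∈ Set.Icc (-(σ / δ)) (σ / δ)} := by
    rintro _ ⟨_, ⟨_, ⟨b, hb, rfl⟩, rfl⟩, rfl⟩ i
    set y : E n := x₀ + Matrix.toEuclideanLin A b
    have hy : y ∈ S := hQS ⟨_, ⟨b, hb, rfl⟩, rfl⟩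
    have key : ∀ c : ℝ, |c| ≤ δ → c * (Matrix.toEuclideanLin A.transpose (gradMap φ y)) i ≤ σ := by
      intro c hc
      have hc' := abs_le.1 hc
      have hz : x₀ + Matrix.toEuclideanLin A (b + EuclideanSpace.single i c) ∈ closure S := by
        refine mem_of_sum_le_one hKc hx₀ hA (fun j => ?_) ?_
        · by_cases hij : j = i
          · subst hij; simp; linarith [(hb j).1]
          · simp [hij]; linarith [(hb j).1]
        · simp only [PiLp.add_apply, Finset.sum_add_distrib]
          have : ∑ j, (EuclideanSpace.single i c : E n) j = c := by simp
          have h3 : δ ≤ n * δ := le_mul_of_one_le_left hδ0.le (by exact_mod_cast hn)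
          linarith [hsum b hb]
      have h1 := h.convexOn.add_fderiv_le (subset_closure hy) hz
        ((h.smooth y hy).differentiableAt (by simp))
      have h2 : x₀ + Matrix.toEuclideanLin A (b + EuclideanSpace.single i c) - y
          = Matrix.toEuclideanLin A (EuclideanSpace.single i c) := by
        simp only [y, map_add]; abel
      rw [h2, ← inner_gradMap, inner_toEuclideanLin,
        EuclideanSpace.inner_single_right] at h1
      have h3 := h.le _ hz
      have h4 := h.nonneg y (subset_closure hy)
      rw [conj_trivial] at h1
      linarith
    have k1 := key δ (abs_of_pos hδ0).le
    have k2 := key (-δ) (by rw [abs_neg]; exact (abs_of_pos hδ0).le)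
    constructor
    · rw [neg_le, le_div_iff₀ hδ0]; linarith
    · rw [le_div_iff₀ hδ0]; linarith
  have hvol := (h.mul_volume_le_volume_image hlam hQc.measurableSet hQS).trans (measure_mono hgrad)
  have hdetT : LinearMap.det (Matrix.toEuclideanLin A.transpose) = A.det := by
    rw [LinearMap.det_toLpLin, Matrix.det_transpose]
  rw [Measure.addHaar_preimage_linearMap _ (by rwa [hdetT]), hdetT,
    show Q = (fun y => x₀ + y) '' (Matrix.toEuclideanLin A '' B) from rfl, Set.image_add_left,
    measure_preimage_add, Measure.addHaar_image_linearMap, LinearMap.det_toLpLin,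
    volume_box (fun _ => δ) (fun _ => 2 * δ), volume_box (fun _ => -(σ / δ)) (fun _ => σ / δ),
    Finset.prod_const, Finset.prod_const, Finset.card_univ, Fintype.card_fin,
    ← ENNReal.ofReal_pow (by linarith), ← ENNReal.ofReal_pow (by rw [sub_neg_eq_add]; positivity),
    ← ENNReal.ofReal_mul (abs_nonneg _), ← ENNReal.ofReal_mul (abs_nonneg _),
    ← ENNReal.ofReal_mul hlam.le, ENNReal.ofReal_le_ofReal_iff (by
      rw [sub_neg_eq_add]; positivity), abs_inv, inv_mul_eq_div,
    le_div_iff₀ (abs_pos.2 hdet)] at hvol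
  have e1 : 2 * δ - δ = δ := by ring
  rw [e1] at hvol
  have e2 : lam * (|A.det| * δ ^ n) * |A.det| = (A.det ^ 2 * lam) * δ ^ n := by
    rw [← sq_abs A.det]; ring
  have e3 : (σ / δ - -(σ / δ)) ^ n = ((18 * n ^ 2) ^ n * σ ^ n) * δ ^ n := by
    rw [← mul_pow, ← mul_pow]
    congr 1
    rw [hδ]; field_simp; ring
  rw [e2, e3] at hvol
  rw [le_div_iff₀ hlam]
  exact le_of_mul_le_mul_right hvol (by positivity)

/-- Every sufficiently small slope is attained by the gradient. -/
theorem mem_image_gradMap (h : IsConvexSublevel S x₀ φ σ lam Lam) {p : E n}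
    (hp : ∀ x ∈ closure S, inner ℝ p (x - x₀) < σ) : p ∈ gradMap φ '' S := by
  obtain ⟨z, hz, hmin⟩ := h.isCompact.exists_isMinOn ⟨x₀, subset_closure h.mem⟩
    (f := fun x => φ x - inner ℝ p (x - x₀)) (h.continuousOn.sub (by fun_prop))
  have hzS : z ∈ S := by
    by_contra hzS
    have h1 := hmin (subset_closure h.mem)
    simp only [Set.mem_ofPred_eq, h.eq_zero, sub_self, inner_zero_right] at h1
    linarith [h.ge z ⟨hz, hzS⟩, hp z hz]
  refine ⟨z, hzS, ?_⟩
  have hloc : IsLocalMin (fun x => φ x - inner ℝ p (x - x₀)) z :=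
    (hmin.on_subset subset_closure).isLocalMin (h.isOpen.mem_nhds hzS)
  have hd := ((h.smooth z hzS).differentiableAt (by simp)).hasFDerivAt
  have hd2 : HasFDerivAt (fun x => inner ℝ p (x - x₀)) (innerSL ℝ p) z := by
    simpa [inner_sub_right] using ((innerSL ℝ p).hasFDerivAt (x := z)).sub_const (inner ℝ p x₀)
  have h0 := hloc.hasFDerivAt_eq_zero (hd.sub hd2)
  refine ext_inner_right ℝ fun w => ?_
  rw [inner_gradMap]
  have := congrArg (fun L => L w) h0
  simpa [sub_eq_zero] using this

theorem abs_inner_frame_le (h : IsConvexSublevel S x₀ φ σ lam Lam) (hn : 1 ≤ n) (hlam : 0 < lam)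
    (hL : 0 ≤ Lam) (hσ : 0 < σ) {A : Matrix (Fin n) (Fin n) ℝ} (hdet : A.det ≠ 0)
    (hA : ∀ j, x₀ + WithLp.toLp 2 (A.col j) ∈ closure S)
    (hA' : ∀ x ∈ closure S, ∃ a : E n, (∀ i, |a i| ≤ 1) ∧ x = x₀ + Matrix.toEuclideanLin A a)
    {G : Fin n → ℝ} {f₀ : ℝ} (hf₀ : 0 < f₀)
    (hG : ∀ a : E n, x₀ + Matrix.toEuclideanLin A a ∈ closure S → -∑ j, G j * a j ≤ f₀)
    (i : Fin n) : |G i| ≤ 2 / n * (72 * n ^ 3) ^ n * (Lam / lam) * f₀ := by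
  have hn0 : (0 : ℝ) < n := by exact_mod_cast hn
  set N' : Matrix (Fin n) (Fin n) ℝ := (1 : Matrix (Fin n) (Fin n) ℝ).updateRow i (-G)
  have hN' : N'.det = -G i := by
    rw [← Matrix.cramer_transpose_apply, Matrix.transpose_one, Matrix.cramer_one]; rfl
  set l : Fin n → ℝ := fun j => if j = i then 0 else -(σ / (4 * n))
  set r : Fin n → ℝ := fun j => if j = i then σ / (4 * f₀) else σ / (4 * n)
  set B : Set (E n) := {p : E n | ∀ j, p j ∈ Set.Icc (l j) (r j)}
  set P : Set (E n) := Matrix.toEuclideanLin A.transpose ⁻¹'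
    (Matrix.toEuclideanLin N'.transpose '' B) with hP
  have hPS : P ⊆ gradMap φ '' S := by
    rintro p ⟨c, hc, hcp⟩
    refine h.mem_image_gradMap fun x hx => ?_
    obtain ⟨a, ha, rfl⟩ := hA' x hx
    rw [add_sub_cancel_left, inner_toEuclideanLin, ← hcp, ← inner_toEuclideanLin]
    have hterm : ∀ j, c j * (Matrix.toEuclideanLin N' a) j
        ≤ (if j = i then σ / 4 else 0) + σ / (4 * n) := by
      intro j
      have hcj := hc j
      have hpos : 0 < σ / (4 * n) := by positivity
      by_cases hj : j = i
      · subst hj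
        have e : (Matrix.toEuclideanLin N' a) j = -∑ k, G k * a k := by
          simp [Matrix.toLpLin_apply, Matrix.mulVec, dotProduct, N']
        simp only [l, r, if_true] at hcj
        rw [e, if_pos rfl]
        have h1 : c j * -∑ k, G k * a k ≤ σ / (4 * f₀) * f₀ :=
          (mul_le_mul_of_nonneg_left (hG a hx) hcj.1).trans
            (mul_le_mul_of_nonneg_right hcj.2 hf₀.le)
        have h2 : σ / (4 * f₀) * f₀ = σ / 4 := by field_simp
        linarith
      · have e : (Matrix.toEuclideanLin N' a) j = a j := by
          simp [Matrix.toLpLin_apply, Matrix.mulVec, dotProduct, N', hj, Matrix.one_apply]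
        simp only [l, r, if_neg hj] at hcj
        rw [e, if_neg hj, zero_add]
        calc c j * a j ≤ |c j * a j| := le_abs_self _
          _ = |c j| * |a j| := abs_mul _ _
          _ ≤ σ / (4 * n) * 1 := mul_le_mul (abs_le.2 hcj) (ha j) (abs_nonneg _) hpos.le
          _ = _ := mul_one _
    have hsum : inner ℝ c (Matrix.toEuclideanLin N' a)
        = ∑ j, c j * (Matrix.toEuclideanLin N' a) j := by
      simp [PiLp.inner_apply, mul_comm]
    rw [hsum]
    refine (Finset.sum_le_sum fun j _ => hterm j).trans_lt ?_
    rw [Finset.sum_add_distrib]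
    simp only [Finset.sum_ite_eq', Finset.mem_univ, if_true, Finset.sum_const, Finset.card_univ,
      Fintype.card_fin, nsmul_eq_mul]
    have : n * (σ / (4 * n)) = σ / 4 := by field_simp
    linarith
  have hS : volume S ≤ ENNReal.ofReal (2 ^ n * |A.det|) :=
    (measure_mono subset_closure).trans (volume_le_of_frame hA')
  have hvol := ((measure_mono hPS).trans (h.volume_image_le_mul_volume hlam)).trans
    (mul_le_mul_right hS _)
  have hdetT : LinearMap.det (Matrix.toEuclideanLin A.transpose) = A.det := by
    rw [LinearMap.det_toLpLin, Matrix.det_transpose]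
  have hprod : ∏ j, ENNReal.ofReal (r j - l j)
      = ENNReal.ofReal ((σ / (2 * n)) ^ n * (n / (2 * f₀))) := by
    have e : ∀ j, r j - l j = σ / (2 * n) * (if j = i then n / (2 * f₀) else 1) := by
      intro j
      by_cases hj : j = i
      · simp only [r, l, hj, if_true]; field_simp; ring
      · simp only [r, l, if_neg hj]; field_simp; ring
    rw [← ENNReal.ofReal_prod_of_nonneg]
    · simp only [e, Finset.prod_mul_distrib, Finset.prod_const, Finset.card_univ, Fintype.card_fin,
        Finset.prod_ite_eq', Finset.mem_univ, if_true]
    · intro j _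
      rw [e]
      split_ifs <;> positivity
  rw [hP, Measure.addHaar_preimage_linearMap _ (by rwa [hdetT]), hdetT,
    Measure.addHaar_image_linearMap, LinearMap.det_toLpLin, Matrix.det_transpose, hN',
    volume_box, hprod, ← ENNReal.ofReal_mul (abs_nonneg _), ← ENNReal.ofReal_mul (abs_nonneg _),
    ← ENNReal.ofReal_mul hL, ENNReal.ofReal_le_ofReal_iff (by positivity), abs_inv,
    inv_mul_le_iff₀ (abs_pos.2 hdet), abs_neg] at hvol
  have hD := h.det_sq_le hn hlam hσ hdet hA
  have e1 : |A.det| * (Lam * (2 ^ n * |A.det|)) = Lam * 2 ^ n * A.det ^ 2 := by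
    rw [← sq_abs A.det]; ring
  rw [e1] at hvol
  have h1 := hvol.trans (mul_le_mul_of_nonneg_left hD (by positivity))
  have h2 : 0 < (σ / (2 * n)) ^ n * (n / (2 * f₀)) := by positivity
  rw [← le_div_iff₀ h2] at h1
  refine h1.trans (le_of_eq ?_)
  have e2 : (72 * (n : ℝ) ^ 3) ^ n = 2 ^ n * (18 * n ^ 2) ^ n * (2 * n) ^ n := by
    rw [← mul_pow, ← mul_pow]; congr 1; ring
  rw [e2, div_pow]
  field_simp

theorem exists_frame_bounds (h : IsConvexSublevel S x₀ φ σ lam Lam) (hn : 1 ≤ n) (hlam : 0 < lam)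
    (hL : 0 ≤ Lam) (hσ : 0 < σ) :
    (volume S).toReal ≤ 2 ^ n * √((18 * n ^ 2) ^ n * σ ^ n / lam) ∧
    ∀ M : ℝ, (∀ x ∈ closure S, ‖x‖ ^ 2 ≤ M) → ‖x₀‖ ^ 2 < M → ∀ x ∈ closure S,
      M - ‖x‖ ^ 2 ≤ (1 + 2 * (72 * n ^ 3) ^ n * (Lam / lam)) * (M - ‖x₀‖ ^ 2) := by
  obtain ⟨A, hdet, hA, hA'⟩ := exists_maximal_frame h.isCompact (x₀ := x₀)
    (interior_mono subset_closure (by rw [h.isOpen.interior_eq]; exact h.mem))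
  constructor
  · have hD := h.det_sq_le hn hlam hσ hdet hA
    have h1 : volume S ≤ ENNReal.ofReal (2 ^ n * |A.det|) :=
      (measure_mono subset_closure).trans (volume_le_of_frame hA')
    refine (ENNReal.toReal_le_of_le_ofReal (by positivity) h1).trans ?_
    have := Real.abs_le_sqrt hD
    gcongr
  · intro M hM hM0 x hx
    have hn0 : (0 : ℝ) < n := by exact_mod_cast hn
    set G : Fin n → ℝ := fun j => -2 * (Matrix.toEuclideanLin A.transpose x₀) j
    have key : ∀ a : E n, M - ‖x₀ + Matrix.toEuclideanLin A a‖ ^ 2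
        = (M - ‖x₀‖ ^ 2) + ∑ j, G j * a j - ‖Matrix.toEuclideanLin A a‖ ^ 2 := by
      intro a
      rw [norm_add_sq_real, inner_toEuclideanLin]
      have : ∑ j, G j * a j = -2 * inner ℝ (Matrix.toEuclideanLin A.transpose x₀) a := by
        simp only [G, PiLp.inner_apply, Finset.mul_sum, RCLike.inner_apply, conj_trivial]
        exact Finset.sum_congr rfl fun j _ => by ring
      rw [this]; ring
    have hGb := h.abs_inner_frame_le hn hlam hL hσ hdet hA hA' (G := G) (sub_pos.2 hM0)
      (fun a ha => by
        have h1 := hM _ ha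
        have h2 := key a
        have h3 := sq_nonneg ‖Matrix.toEuclideanLin A a‖
        linarith)
    obtain ⟨a, ha, rfl⟩ := hA' x hx
    rw [key]
    have hs : ∑ j, G j * a j ≤ ∑ _j : Fin n, 2 / n * (72 * n ^ 3) ^ n * (Lam / lam)
        * (M - ‖x₀‖ ^ 2) := by
      refine Finset.sum_le_sum fun j _ => ?_
      calc G j * a j ≤ |G j * a j| := le_abs_self _
        _ = |G j| * |a j| := abs_mul _ _
        _ ≤ |G j| * 1 := mul_le_mul_of_nonneg_left (ha j) (abs_nonneg _)
        _ ≤ _ := by rw [mul_one]; exact hGb j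
    have e : ∑ _j : Fin n, 2 / (n : ℝ) * (72 * n ^ 3) ^ n * (Lam / lam) * (M - ‖x₀‖ ^ 2)
        = 2 * (72 * n ^ 3) ^ n * (Lam / lam) * (M - ‖x₀‖ ^ 2) := by
      simp only [Finset.sum_const, Finset.card_univ, Fintype.card_fin, nsmul_eq_mul]
      field_simp
    have h3 := sq_nonneg ‖Matrix.toEuclideanLin A a‖
    linarith

end IsConvexSublevel

theorem Matrix.PosDef.sum_mul_nonneg {A : Matrix (Fin n) (Fin n) ℝ} (hA : A.PosDef)
    (ξ : Fin n → ℝ) : 0 ≤ ∑ i, ∑ j, A i j * (ξ i * ξ j) := by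
  have h := hA.posSemidef.dotProduct_mulVec_nonneg ξ
  refine h.trans_eq ?_
  simp only [star_trivial, dotProduct, Matrix.mulVec, Finset.mul_sum]
  exact Finset.sum_congr rfl fun i _ => Finset.sum_congr rfl fun j _ => by ring

theorem continuousAt_trace_cofU {φ : E n → ℝ} {x : E n}
    (hφ : ContDiffAt ℝ (⊤ : ℕ∞) φ x) : ContinuousAt (fun y => (cofU φ y).trace) x := by
  simp only [Matrix.trace, Matrix.diag_apply]
  exact tendsto_finsetSum _ fun i _ => (hφ.cofU i i).continuousAt

/-- Trace estimate with general cut-off profiles `h` and `K`. -/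
theorem mul_integral_trace_le {V S T : Set (E n)} (hV : IsOpen V) (hS : IsCompact (closure S))
    (hSV : closure S ⊆ V) (hT : MeasurableSet T) (hTS : T ⊆ S) {φ : E n → ℝ}
    (hφ : ∀ x ∈ V, ContDiffAt ℝ (⊤ : ℕ∞) φ x) (hpos : ∀ x ∈ V, (Hess φ x).PosDef)
    {Lam : ℝ} (hLam : ∀ x ∈ V, (Hess φ x).det ≤ Lam) {M F : ℝ} (hM : ∀ x ∈ V, ‖x‖ ^ 2 < M)
    (hF : ∀ x ∈ closure S, M - ‖x‖ ^ 2 ≤ F) {h K : ℝ → ℝ}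
    (hh : ∀ x ∈ V, ContDiffAt ℝ 1 h (φ x)) (hK : ∀ x ∈ V, ContDiffAt ℝ 1 K (φ x))
    (hKh : ∀ x ∈ V, deriv K (φ x) ≤ -(deriv h (φ x)) ^ 2)
    (hh0 : ∀ x ∈ V \ S, h (φ x) = 0) (hK0 : ∀ x ∈ V \ S, K (φ x) = 0)
    (hKnn : ∀ x ∈ V, 0 ≤ K (φ x)) (hF0 : 0 ≤ F)
    {m : ℝ} (hm : 0 ≤ m) (hmT : ∀ x ∈ T, m ≤ h (φ x)) :
    m ^ 2 * ∫ x in T, (cofU φ x).trace ≤ F * (n / 2) * Lam * ∫ x in S, K (φ x) := by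
  have hTV : T ⊆ V := (hTS.trans subset_closure).trans hSV
  have htr : ∀ x ∈ V, 0 ≤ (cofU φ x).trace := fun x hx =>
    (hpos x hx).adjugate.posSemidef.trace_nonneg
  have hφc : ∀ x ∈ V, ContinuousAt φ x := fun x hx => (hφ x hx).continuousAt
  have hKc : ∀ x ∈ V, ContinuousAt (fun x => K (φ x)) x := fun x hx =>
    (hK x hx).continuousAt.comp (hφc x hx)
  have hhc : ∀ x ∈ V, ContinuousAt (fun x => h (φ x)) x := fun x hx =>
    (hh x hx).continuousAt.comp (hφc x hx)
  have hsub : V \ closure S ⊆ V \ S := Set.sdiff_subset_sdiff_right subset_closure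
  have hInt : IntegrableOn (fun x => h (φ x) ^ 2 * (cofU φ x).trace / (M - ‖x‖ ^ 2)) V := by
    refine integrableOn_of_continuousAt_of_eq_zero hV hS hSV (fun x hx => ?_) fun x hx => ?_
    · exact (((hhc x hx).pow 2).mul (continuousAt_trace_cofU (hφ x hx))).div (by fun_prop)
        (sub_pos.2 (hM x hx)).ne'
    · simp [hh0 x (hsub hx)]
  have hintK : IntegrableOn (fun x => K (φ x)) V :=
    integrableOn_of_continuousAt_of_eq_zero hV hS hSV hKc fun x hx => hK0 x (hsub hx)
  have hintKd : IntegrableOn (fun x => K (φ x) * (Hess φ x).det) V := by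
    refine integrableOn_of_continuousAt_of_eq_zero hV hS hSV (fun x hx => ?_) fun x hx => ?_
    · exact (hKc x hx).mul (ContDiffAt.matrix_det fun i j => (hφ x hx).hess i j).continuousAt
    · simp [hK0 x (hsub hx)]
  have hIntT : IntegrableOn (fun x => (cofU φ x).trace) T :=
    (ContinuousOn.integrableOn_compact hS fun x hx =>
      (continuousAt_trace_cofU (hφ x (hSV hx))).continuousWithinAt).mono_set
      (hTS.trans subset_closure)
  have hE := energy_inequality hV hS hSV hφ (fun x hx => (hpos x hx).det_pos.ne')
    (fun x hx => (hpos x hx).adjugate.sum_mul_nonneg) hM hh hK hKh hh0 hK0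
  have h1 : m ^ 2 * ∫ x in T, (cofU φ x).trace
      ≤ F * ∫ x in V, h (φ x) ^ 2 * (cofU φ x).trace / (M - ‖x‖ ^ 2) := by
    rw [← integral_const_mul, ← integral_const_mul]
    calc ∫ x in T, m ^ 2 * (cofU φ x).trace
        ≤ ∫ x in T, F * (h (φ x) ^ 2 * (cofU φ x).trace / (M - ‖x‖ ^ 2)) := by
          refine setIntegral_mono_on (hIntT.const_mul _) ((hInt.mono_set hTV).const_mul _) hT
            fun x hx => ?_
          have hf := sub_pos.2 (hM x (hTV hx))
          rw [← mul_div_assoc, le_div_iff₀ hf]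
          have a1 : m ^ 2 * (cofU φ x).trace ≤ h (φ x) ^ 2 * (cofU φ x).trace :=
            mul_le_mul_of_nonneg_right (pow_le_pow_left₀ hm (hmT x hx) 2) (htr x (hTV hx))
          have a2 := hF x (subset_closure (hTS hx))
          rw [mul_comm F]
          exact mul_le_mul a1 a2 hf.le (mul_nonneg (sq_nonneg _) (htr x (hTV hx)))
      _ ≤ ∫ x in V, F * (h (φ x) ^ 2 * (cofU φ x).trace / (M - ‖x‖ ^ 2)) := by
          refine setIntegral_mono_set (hInt.const_mul _) ?_ hTV.eventuallyLE
          refine (ae_restrict_iff' hV.measurableSet).2 (Filter.Eventually.of_forall fun x hx => ?_)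
          exact mul_nonneg hF0 (div_nonneg (mul_nonneg (sq_nonneg _) (htr x hx))
            (sub_pos.2 (hM x hx)).le)
  have h2 : ∫ x in V, K (φ x) * (Hess φ x).det ≤ Lam * ∫ x in S, K (φ x) := by
    have e : ∫ x in S, K (φ x) = ∫ x in V, K (φ x) :=
      (setIntegral_eq_of_subset_of_forall_sdiff_eq_zero hV.measurableSet
        (subset_closure.trans hSV) hK0).symm
    rw [e, ← integral_const_mul]
    refine setIntegral_mono_on hintKd (hintK.const_mul _) hV.measurableSet fun x hx => ?_
    rw [mul_comm]
    exact mul_le_mul_of_nonneg_right (hLam x hx) (hKnn x hx)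
  have h3 := mul_le_mul_of_nonneg_left h2 (Nat.cast_nonneg (α := ℝ) n)
  calc _ ≤ _ := h1
    _ ≤ F * ((n / 2) * (Lam * ∫ x in S, K (φ x))) :=
      mul_le_mul_of_nonneg_left (by linarith) hF0
    _ = _ := by ring

theorem hasDerivAt_max_zero_sq (y : ℝ) : HasDerivAt (fun y : ℝ => max y 0 ^ 2) (2 * max y 0) y := by
  rcases lt_trichotomy y 0 with hy | rfl | hy
  · rw [max_eq_right hy.le, mul_zero]
    refine (hasDerivAt_const y (0 : ℝ)).congr_of_eventuallyEq ?_
    filter_upwards [gt_mem_nhds hy] with z hz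
    simp [max_eq_right hz.le]
  · rw [max_self, mul_zero, hasDerivAt_iff_isLittleO_nhds_zero]
    have h : (fun y : ℝ => y ^ 2) =o[nhds 0] fun y => y := by
      simpa using Asymptotics.isLittleO_pow_id (𝕜 := ℝ) (n := 2) (by norm_num)
    refine Asymptotics.IsBigO.trans_isLittleO (Asymptotics.IsBigO.of_bound 1 ?_) h
    refine Filter.Eventually.of_forall fun z => ?_
    rcases le_total z 0 with hz | hz
    · simp [hz]; positivity
    · simp [hz]
  · rw [max_eq_left hy.le]
    have h := (hasDerivAt_pow 2 y)
    refine (h.congr_deriv (by simp)).congr_of_eventuallyEq ?_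
    filter_upwards [lt_mem_nhds hy] with z hz
    simp [max_eq_left hz.le]

theorem contDiff_max_zero_sq : ContDiff ℝ 1 fun y : ℝ => max y 0 ^ 2 := by
  rw [contDiff_one_iff_deriv]
  refine ⟨fun y => (hasDerivAt_max_zero_sq y).differentiableAt, ?_⟩
  rw [funext fun y => (hasDerivAt_max_zero_sq y).deriv]
  fun_prop

/-- The sublevel sets `{φ < σ}`, `0 < σ ≤ s`, in an open set `V` on which `φ` is smooth and
locally uniformly convex, with the one of height `s` compactly contained in `V`. -/
structure IsSublevelFamily (V : Set (E n)) (x₀ : E n) (φ : E n → ℝ) (s lam Lam : ℝ) : Prop where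
  isOpen : IsOpen V
  smooth : ∀ x ∈ V, ContDiffAt ℝ (⊤ : ℕ∞) φ x
  posDef : ∀ x ∈ V, (Hess φ x).PosDef
  det_le : ∀ x ∈ V, (Hess φ x).det ≤ Lam
  nonneg : ∀ x ∈ V, 0 ≤ φ x
  closure_subset : closure {x ∈ V | φ x < s} ⊆ V
  sublevel : ∀ σ, 0 < σ → σ ≤ s → IsConvexSublevel {x ∈ V | φ x < σ} x₀ φ σ lam Lam

/-- The constant in the volume bound for sublevel sets. -/
def volumeConst (n : ℕ) (lam : ℝ) : ℝ := 2 ^ n * √((18 * n ^ 2) ^ n / lam)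

/-- The constant comparing `M - |x|²` with its value at the centre of the sublevel set. -/
def distortionConst (n : ℕ) (lam Lam : ℝ) : ℝ := 1 + 2 * (72 * n ^ 3) ^ n * (Lam / lam)

namespace IsSublevelFamily

variable {V : Set (E n)} {x₀ : E n} {φ : E n → ℝ} {s lam Lam : ℝ}

theorem volume_le (h : IsSublevelFamily V x₀ φ s lam Lam) (hn : 1 ≤ n) (hlam : 0 < lam)
    (hL : 0 ≤ Lam) {σ : ℝ} (hσ : 0 < σ) (hσs : σ ≤ s) :
    volume.real {x ∈ V | φ x < σ} ≤ volumeConst n lam * √(σ ^ n) := by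
  refine ((h.sublevel σ hσ hσs).exists_frame_bounds hn hlam hL hσ).1.trans (le_of_eq ?_)
  rw [volumeConst, mul_assoc, ← Real.sqrt_mul (by positivity)]
  congr 2
  ring

theorem mul_integral_trace_le (h : IsSublevelFamily V x₀ φ s lam Lam) (hn : 1 ≤ n)
    (hlam : 0 < lam) (hL : 0 ≤ Lam) {M : ℝ} (hM : ∀ x ∈ V, ‖x‖ ^ 2 < M) (hs : 0 < s) {t : ℝ}
    (hts : t ≤ s) {f K : ℝ → ℝ} (hf : ∀ τ, 0 ≤ τ → ContDiffAt ℝ 1 f τ)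
    (hK : ∀ τ, 0 ≤ τ → ContDiffAt ℝ 1 K τ)
    (hKf : ∀ τ, 0 ≤ τ → deriv K τ ≤ -(deriv f τ) ^ 2) (hf0 : ∀ τ, s ≤ τ → f τ = 0)
    (hK0 : ∀ τ, s ≤ τ → K τ = 0) (hKnn : ∀ τ, 0 ≤ τ → 0 ≤ K τ) {m : ℝ} (hm : 0 ≤ m)
    (hmf : ∀ τ, 0 ≤ τ → τ < t → m ≤ f τ) :
    m ^ 2 * ∫ x in {x ∈ V | φ x < t}, (cofU φ x).trace
      ≤ distortionConst n lam Lam * (M - ‖x₀‖ ^ 2) * (n / 2) * Lam *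
        ∫ x in {x ∈ V | φ x < s}, K (φ x) := by
  have hS := h.sublevel s hs le_rfl
  have hx₀ : x₀ ∈ V := hS.mem.1
  have hge : ∀ x ∈ V \ {x ∈ V | φ x < s}, s ≤ φ x := fun x hx => by
    by_contra hc
    exact hx.2 ⟨hx.1, not_le.1 hc⟩
  have hTo : IsOpen {x ∈ V | φ x < t} :=
    ContinuousOn.isOpen_inter_preimage
      (fun x hx => (h.smooth x hx).continuousAt.continuousWithinAt) h.isOpen isOpen_Iio
  have hb := (hS.exists_frame_bounds hn hlam hL hs).2 M
    (fun x hx => (hM x (h.closure_subset hx)).le) (hM x₀ hx₀)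
  refine _root_.mul_integral_trace_le h.isOpen hS.isCompact h.closure_subset
    hTo.measurableSet (fun x hx => ⟨hx.1, hx.2.trans_le hts⟩) h.smooth h.posDef h.det_le hM hb
    (fun x hx => hf _ (h.nonneg x hx)) (fun x hx => hK _ (h.nonneg x hx))
    (fun x hx => hKf _ (h.nonneg x hx)) (fun x hx => hf0 _ (hge x hx))
    (fun x hx => hK0 _ (hge x hx)) (fun x hx => hKnn _ (h.nonneg x hx)) ?_ hm
    fun x hx => hmf _ (h.nonneg x hx.1) hx.2
  have h1 := hb x₀ (subset_closure hS.mem)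
  have h2 := hM x₀ hx₀
  linarith

theorem setIntegral_le_mul_volume (h : IsSublevelFamily V x₀ φ s lam Lam) {σ : ℝ} (hσ : 0 < σ)
    (hσs : σ ≤ s) {A : Set (E n)} (hA : A ⊆ {x ∈ V | φ x < σ}) {g : E n → ℝ} {c : ℝ}
    (hc : 0 ≤ c) (hgc : ∀ x ∈ A, |g x| ≤ c) :
    ∫ x in A, g x ≤ c * volume.real {x ∈ V | φ x < σ} := by
  have hfin : volume {x ∈ V | φ x < σ} < ⊤ :=
    (measure_mono subset_closure).trans_lt (h.sublevel σ hσ hσs).isCompact.measure_lt_top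
  have h1 := norm_setIntegral_le_of_norm_le_const ((measure_mono hA).trans_lt hfin) (f := g) hgc
  refine ((le_abs_self _).trans h1).trans (mul_le_mul_of_nonneg_left ?_ hc)
  exact measureReal_mono hA hfin.ne

theorem integral_trace_le_rpow {t : ℝ} (h : IsSublevelFamily V x₀ φ (2 * t) lam Lam) (hn : 1 ≤ n)
    (hlam : 0 < lam) (hL : 0 ≤ Lam) {M : ℝ} (hM : ∀ x ∈ V, ‖x‖ ^ 2 < M) (ht : 0 < t) :
    ∫ x in {x ∈ V | φ x < t}, (cofU φ x).trace
      ≤ 16 * distortionConst n lam Lam * (n / 2) * Lam * volumeConst n lam * √(2 ^ n) *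
        t ^ (((n : ℝ) - 2) / 2) * (M - ‖x₀‖ ^ 2) := by
  have hd : ∀ τ : ℝ, HasDerivAt (fun τ => max (2 * t - τ) 0 ^ 2) (-(2 * max (2 * t - τ) 0)) τ := by
    intro τ
    have := (hasDerivAt_max_zero_sq (2 * t - τ)).comp τ ((hasDerivAt_id τ).const_sub (2 * t))
    exact this.congr_deriv (by ring)
  have hC : ContDiff ℝ 1 fun τ : ℝ => max (2 * t - τ) 0 ^ 2 :=
    contDiff_max_zero_sq.comp (contDiff_const.sub contDiff_id)
  have h0 : ∀ τ, 2 * t ≤ τ → max (2 * t - τ) 0 ^ 2 = 0 := fun τ hτ => by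
    rw [max_eq_right (by linarith)]; norm_num
  have hle : ∀ τ, 0 ≤ τ → max (2 * t - τ) 0 ≤ 2 * t := fun τ hτ =>
    max_le (by linarith) (by linarith)
  have key := h.mul_integral_trace_le hn hlam hL hM (by positivity) (t := t) (by linarith)
    (f := fun τ => max (2 * t - τ) 0 ^ 2) (K := fun τ => 4 * t * max (2 * t - τ) 0 ^ 2)
    (fun τ _ => hC.contDiffAt) (fun τ _ => contDiffAt_const.mul hC.contDiffAt)
    (fun τ hτ => by
      rw [(hd τ).deriv, ((hd τ).const_mul (4 * t)).deriv]
      nlinarith [hle τ hτ, le_max_right (2 * t - τ) 0])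
    h0 (fun τ hτ => by simp only [h0 τ hτ, mul_zero]) (fun τ _ => by positivity)
    (m := t ^ 2) (by positivity) (fun τ _ hτ => by
      refine pow_le_pow_left₀ ht.le (le_max_of_le_left (by linarith)) 2)
  have hI := h.setIntegral_le_mul_volume (σ := 2 * t) (by positivity) le_rfl (Set.Subset.refl _)
    (g := fun x => 4 * t * max (2 * t - φ x) 0 ^ 2) (c := 16 * t ^ 3) (by positivity)
    (fun x hx => by
      rw [abs_of_nonneg (by positivity)]
      have h1 := hle _ (h.nonneg x hx.1)
      have h2 := pow_le_pow_left₀ (le_max_right _ _) h1 2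
      calc 4 * t * max (2 * t - φ x) 0 ^ 2 ≤ 4 * t * (2 * t) ^ 2 := by gcongr
        _ = _ := by ring)
  have hv := h.volume_le hn hlam hL (σ := 2 * t) (by positivity) le_rfl
  have hx₀ : x₀ ∈ V := (h.sublevel (2 * t) (by positivity) le_rfl).mem.1
  have hf := sub_pos.2 (hM x₀ hx₀)
  have hD : 0 ≤ distortionConst n lam Lam := by rw [distortionConst]; positivity
  have h1 := key.trans (mul_le_mul_of_nonneg_left
    (hI.trans (mul_le_mul_of_nonneg_left hv (by positivity))) (by positivity))
  have e : √((2 * t) ^ n) = √(2 ^ n) * (t ^ (((n : ℝ) - 2) / 2) * t) := by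
    rw [mul_pow, Real.sqrt_mul (by positivity)]
    congr 1
    have : t ^ (((n : ℝ) - 2) / 2) * t = t ^ ((n : ℝ) / 2) := by
      conv_lhs => rw [← Real.rpow_one t, ← Real.rpow_mul ht.le, one_mul, ← Real.rpow_add ht]
      congr 1; ring
    rw [this, Real.sqrt_eq_rpow, ← Real.rpow_natCast, ← Real.rpow_mul ht.le]
    congr 1; ring
  rw [e] at h1
  have ht4 : 0 < (t ^ 2) ^ 2 := by positivity
  refine le_of_mul_le_mul_left (h1.trans (le_of_eq ?_)) ht4
  ring

theorem integrableOn_inv_add (h : IsSublevelFamily V x₀ φ s lam Lam) (hs : 0 < s) {t : ℝ}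
    (ht : 0 < t) : IntegrableOn (fun x => (φ x + t)⁻¹) {x ∈ V | φ x < s} := by
  refine IntegrableOn.mono_set ?_ subset_closure
  refine ContinuousOn.integrableOn_compact (h.sublevel s hs le_rfl).isCompact fun x hx => ?_
  have hx' := h.closure_subset hx
  have := h.nonneg x hx'
  exact (((h.smooth x hx').continuousAt.add continuousAt_const).inv₀
    (show φ x + t ≠ 0 by positivity)).continuousWithinAt

theorem integral_inv_add_le (h : IsSublevelFamily V x₀ φ s lam Lam) {c : ℝ}
    (hvol : ∀ σ, 0 < σ → σ ≤ s → volume.real {x ∈ V | φ x < σ} ≤ c * σ) {t : ℝ} (ht : 0 < t)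
    (hc : 0 ≤ c) (N : ℕ) : ∀ σ, 0 < σ → σ ≤ s → σ ≤ 2 ^ N * t →
      ∫ x in {x ∈ V | φ x < σ}, (φ x + t)⁻¹ ≤ c * (1 + 2 * N) := by
  induction N with
  | zero =>
    intro σ hσ hσs hσt
    refine (h.setIntegral_le_mul_volume hσ hσs (Set.Subset.refl _) (c := t⁻¹) (by positivity)
      fun x hx => ?_).trans ?_
    · have := h.nonneg x hx.1
      rw [abs_of_nonneg (by positivity)]
      exact inv_anti₀ ht (by linarith)
    · refine (mul_le_mul_of_nonneg_left (hvol σ hσ hσs) (by positivity)).trans ?_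
      have h1 : c * σ ≤ c * t := mul_le_mul_of_nonneg_left (by simpa using hσt) hc
      rw [inv_mul_le_iff₀ ht]
      simp; linarith
  | succ N ih =>
    intro σ hσ hσs hσt
    set A := {x ∈ V | φ x < σ / 2}
    set B := {x ∈ V | φ x < σ} \ A
    have hA : MeasurableSet A := (h.sublevel (σ / 2) (by positivity) (by linarith)).isOpen.measurableSet
    have hB : MeasurableSet B := (h.sublevel σ hσ hσs).isOpen.measurableSet.diff hA
    have hAσ : A ⊆ {x ∈ V | φ x < σ} := fun x hx => ⟨hx.1, hx.2.trans (by linarith)⟩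
    have hInt := (h.integrableOn_inv_add (hσ.trans_le hσs) ht).mono_set
      (show {x ∈ V | φ x < σ} ⊆ {x ∈ V | φ x < s} from fun x hx => ⟨hx.1, hx.2.trans_le hσs⟩)
    have e : {x ∈ V | φ x < σ} = A ∪ B := (Set.union_sdiff_cancel hAσ).symm
    have h1 := ih (σ / 2) (by positivity) (by linarith) (by rw [pow_succ] at hσt; linarith)
    have h2 : ∫ x in B, (φ x + t)⁻¹ ≤ (σ / 2)⁻¹ * volume.real {x ∈ V | φ x < σ} := by
      refine h.setIntegral_le_mul_volume hσ hσs Set.sdiff_subset (by positivity) fun x hx => ?_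
      have := h.nonneg x hx.1.1
      have h3 : σ / 2 ≤ φ x := not_lt.1 fun hlt => hx.2 ⟨hx.1.1, hlt⟩
      rw [abs_of_nonneg (by positivity)]
      exact inv_anti₀ (by positivity) (by linarith)
    have h3 : (σ / 2)⁻¹ * volume.real {x ∈ V | φ x < σ} ≤ (σ / 2)⁻¹ * (c * σ) :=
      mul_le_mul_of_nonneg_left (hvol σ hσ hσs) (by positivity)
    have h4 : (σ / 2)⁻¹ * (c * σ) = 2 * c := by field_simp
    rw [e, setIntegral_union Set.disjoint_sdiff_right hB (hInt.mono_set hAσ)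
      (hInt.mono_set Set.sdiff_subset)]
    push_cast
    linarith

theorem integral_trace_le_log {t : ℝ} (h : IsSublevelFamily V x₀ φ (√t) lam Lam) (hn : n = 2)
    (hlam : 0 < lam) (hL : 0 ≤ Lam) {M : ℝ} (hM : ∀ x ∈ V, ‖x‖ ^ 2 < M) (ht : 0 < t)
    (ht4 : t < 1 / 4) :
    ∫ x in {x ∈ V | φ x < t}, (cofU φ x).trace
      ≤ 5120 * distortionConst n lam Lam * Lam * volumeConst n lam *
        |Real.log t|⁻¹ * (M - ‖x₀‖ ^ 2) := by
  set s := √t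
  have hst : s ^ 2 = t := Real.sq_sqrt ht.le
  have hs : 0 < s := Real.sqrt_pos.2 ht
  have hs2 : s < 1 / 2 := by nlinarith
  have hts : t < s := by nlinarith
  set ℓ := -Real.log t with hℓ
  have hℓs : Real.log s = -ℓ / 2 := by
    rw [← hst, Real.log_pow] at hℓ
    push_cast at hℓ
    linarith
  have hℓ1 : 1 ≤ ℓ := by
    have h1 := Real.log_lt_log ht ht4
    have h2 : Real.log (1 / 4) = -(2 * Real.log 2) := by
      rw [show (1 / 4 : ℝ) = (2 ^ 2)⁻¹ by norm_num, Real.log_inv, Real.log_pow]; norm_num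
    linarith [Real.log_two_gt_d9]
  have habs : |Real.log t| = ℓ := by rw [abs_of_neg (by linarith)]
  set L : ℝ → ℝ := fun τ => Real.log (s + t) - Real.log (τ + t)
  have hLd : ∀ τ, 0 ≤ τ → HasDerivAt L (-(τ + t)⁻¹) τ := fun τ hτ => by
    have h1 := ((hasDerivAt_id τ).add_const t).log (show τ + t ≠ 0 by positivity)
    exact (h1.const_sub (Real.log (s + t))).congr_deriv (by simp)
  have hLc : ∀ τ, 0 ≤ τ → ContDiffAt ℝ 1 L τ := fun τ hτ =>
    contDiffAt_const.sub ((contDiffAt_id.add contDiffAt_const).log (show τ + t ≠ 0 by positivity))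
  have hfd : ∀ τ, 0 ≤ τ → HasDerivAt (fun τ => max (L τ) 0 ^ 2)
      (-(2 * max (L τ) 0 * (τ + t)⁻¹)) τ := fun τ hτ =>
    ((hasDerivAt_max_zero_sq (L τ)).comp τ (hLd τ hτ)).congr_deriv (by ring)
  have hfc : ∀ τ, 0 ≤ τ → ContDiffAt ℝ 1 (fun τ => max (L τ) 0 ^ 2) τ := fun τ hτ =>
    contDiff_max_zero_sq.contDiffAt.comp τ (hLc τ hτ)
  have hKd : ∀ τ, 0 ≤ τ → HasDerivAt (fun τ => 4 * max (L τ) 0 ^ 2 * (τ + t)⁻¹)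
      (4 * -(2 * max (L τ) 0 * (τ + t)⁻¹) * (τ + t)⁻¹
        + 4 * max (L τ) 0 ^ 2 * (-1 / (τ + t) ^ 2)) τ := fun τ hτ =>
    ((hfd τ hτ).const_mul 4).mul
      (((hasDerivAt_id τ).add_const t).fun_inv (show τ + t ≠ 0 by positivity))
  have h0 : ∀ τ, s ≤ τ → max (L τ) 0 = 0 := fun τ hτ =>
    max_eq_right (sub_nonpos.2 (Real.log_le_log (by positivity) (by linarith)))
  have hLle : ∀ τ, 0 ≤ τ → max (L τ) 0 ≤ ℓ := fun τ hτ => by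
    refine max_le ?_ (by linarith)
    have h1 : Real.log t ≤ Real.log (τ + t) := Real.log_le_log ht (by linarith)
    have h2 : Real.log (s + t) ≤ 0 := Real.log_nonpos (by positivity) (by nlinarith)
    simp only [L]
    linarith
  have hLge : ∀ τ, 0 ≤ τ → τ < t → ℓ / 4 ≤ L τ := fun τ hτ hτt => by
    have h1 : Real.log (τ + t) ≤ Real.log (2 * t) := Real.log_le_log (by positivity) (by linarith)
    have h2 : Real.log (2 * √s * s) ≤ Real.log (s + t) := by
      refine Real.log_le_log (by positivity) ?_
      have h3 := Real.sq_sqrt hs.le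
      nlinarith [sq_nonneg (√s - 1), mul_nonneg hs.le (sq_nonneg (√s - 1))]
    have h4 : Real.log (√s) = -ℓ / 4 := by rw [Real.log_sqrt hs.le, hℓs]; ring
    rw [Real.log_mul (by positivity) hs.ne', Real.log_mul two_ne_zero (by positivity), h4,
      hℓs] at h2
    rw [Real.log_mul two_ne_zero ht.ne'] at h1
    simp only [L]
    linarith
  have hn1 : 1 ≤ n := by omega
  have key := h.mul_integral_trace_le hn1 hlam hL hM hs hts.le
    (f := fun τ => max (L τ) 0 ^ 2) (K := fun τ => 4 * max (L τ) 0 ^ 2 * (τ + t)⁻¹) hfc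
    (fun τ hτ => (contDiffAt_const.mul (hfc τ hτ)).mul
      ((contDiffAt_id.add contDiffAt_const).inv (show τ + t ≠ 0 by positivity)))
    (fun τ hτ => by
      rw [(hfd τ hτ).deriv, (hKd τ hτ).deriv]
      have hp : 0 < τ + t := by positivity
      have h1 : 0 ≤ max (L τ) 0 := le_max_right _ _
      have h2 : 0 ≤ 8 * max (L τ) 0 * (τ + t)⁻¹ * (τ + t)⁻¹ := by positivity
      have e : -1 / (τ + t) ^ 2 = -((τ + t)⁻¹ * (τ + t)⁻¹) := by field_simp
      rw [e]
      nlinarith)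
    (fun τ hτ => by simp [h0 τ hτ]) (fun τ hτ => by simp [h0 τ hτ])
    (fun τ hτ => by positivity) (m := (ℓ / 4) ^ 2) (by positivity)
    (fun τ hτ hτt => pow_le_pow_left₀ (by linarith) (le_max_of_le_left (hLge τ hτ hτt)) 2)
  have hV0 : 0 ≤ volumeConst n lam := by rw [volumeConst]; positivity
  have hvol : ∀ σ, 0 < σ → σ ≤ s → volume.real {x ∈ V | φ x < σ} ≤ volumeConst n lam * σ :=
    fun σ hσ hσs => by
      refine (h.volume_le hn1 hlam hL hσ hσs).trans (le_of_eq ?_)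
      rw [hn, Real.sqrt_sq hσ.le]
  have hN : s ≤ 2 ^ ⌈ℓ⌉₊ * t := by
    have h1 : s⁻¹ ≤ 2 ^ ⌈ℓ⌉₊ := by
      rw [← Real.log_le_log_iff (by positivity) (by positivity), Real.log_inv, hℓs, Real.log_pow]
      have h2 := Nat.le_ceil ℓ
      nlinarith [Real.log_two_gt_d9]
    calc s = s⁻¹ * t := by rw [← hst]; field_simp
      _ ≤ _ := mul_le_mul_of_nonneg_right h1 ht.le
  have hinv := h.integral_inv_add_le hvol ht hV0 ⌈ℓ⌉₊ s hs le_rfl hN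
  have hceil : (1 + 2 * (⌈ℓ⌉₊ : ℝ)) ≤ 5 * ℓ := by
    have := Nat.ceil_lt_add_one (by linarith : 0 ≤ ℓ)
    linarith
  have hI : ∫ x in {x ∈ V | φ x < s}, 4 * max (L (φ x)) 0 ^ 2 * (φ x + t)⁻¹
      ≤ 4 * ℓ ^ 2 * (volumeConst n lam * (5 * ℓ)) := by
    refine le_trans ?_ (mul_le_mul_of_nonneg_left
      (hinv.trans (mul_le_mul_of_nonneg_left hceil hV0)) (by positivity))
    rw [← integral_const_mul]
    refine integral_mono_of_nonneg ?_ ((h.integrableOn_inv_add hs ht).const_mul _) ?_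
    · refine (ae_restrict_iff' (h.sublevel s hs le_rfl).isOpen.measurableSet).2
        (Filter.Eventually.of_forall fun x hx => ?_)
      have := h.nonneg x hx.1
      change 0 ≤ 4 * max (L (φ x)) 0 ^ 2 * (φ x + t)⁻¹
      positivity
    · refine (ae_restrict_iff' (h.sublevel s hs le_rfl).isOpen.measurableSet).2
        (Filter.Eventually.of_forall fun x hx => ?_)
      have hx0 := h.nonneg x hx.1
      have := hLle _ hx0
      change 4 * max (L (φ x)) 0 ^ 2 * (φ x + t)⁻¹ ≤ 4 * ℓ ^ 2 * (φ x + t)⁻¹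
      gcongr
  have hx₀ : x₀ ∈ V := (h.sublevel s hs le_rfl).mem.1
  have hf := sub_pos.2 (hM x₀ hx₀)
  have hD : 0 ≤ distortionConst n lam Lam := by rw [distortionConst]; positivity
  have h1 := key.trans (mul_le_mul_of_nonneg_left hI (by positivity))
  rw [habs]
  refine le_of_mul_le_mul_left (h1.trans (le_of_eq ?_)) (show 0 < ((ℓ / 4) ^ 2) ^ 2 by positivity)
  rw [show (n : ℝ) = 2 by rw [hn]; norm_num]
  field_simp
  ring

end IsSublevelFamily

/-- The height of `u` above its tangent plane at `x₀`. -/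
def tangentGap (u : E n → ℝ) (x₀ x : E n) : ℝ := u x - u x₀ - fderiv ℝ u x₀ (x - x₀)

theorem contDiffAt_tangentGap {u : E n → ℝ} (x₀ : E n) {x : E n}
    (hu : ContDiffAt ℝ (⊤ : ℕ∞) u x) : ContDiffAt ℝ (⊤ : ℕ∞) (tangentGap u x₀) x :=
  (hu.sub contDiffAt_const).sub
    ((fderiv ℝ u x₀).contDiff.contDiffAt.comp x (contDiffAt_id.sub contDiffAt_const))

theorem hess_tangentGap {u : E n → ℝ} (x₀ : E n) {x : E n} (hu : ContDiffAt ℝ (⊤ : ℕ∞) u x) :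
    Hess (tangentGap u x₀) x = Hess u x := by
  ext i j
  have h : ∀ᶠ y in nhds x, fderiv ℝ (tangentGap u x₀) y (EuclideanSpace.single j 1)
      = fderiv ℝ u y (EuclideanSpace.single j 1)
        - fderiv ℝ u x₀ (EuclideanSpace.single j 1) := by
    filter_upwards [(hu.of_le (m := 1) (by simp)).eventually (by simp)] with y hy
    have h1 := (hy.differentiableAt (by simp)).hasFDerivAt
    have h2 : HasFDerivAt (fun x => fderiv ℝ u x₀ (x - x₀)) (fderiv ℝ u x₀) y := by
      simpa using ((fderiv ℝ u x₀).hasFDerivAt (x := y)).sub_const (fderiv ℝ u x₀ x₀)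
    have h3 : HasFDerivAt (tangentGap u x₀) (fderiv ℝ u y - fderiv ℝ u x₀) y :=
      (h1.sub_const (u x₀)).sub h2
    rw [h3.fderiv]
    rfl
  change pd2 _ _ _ _ = pd2 _ _ _ _
  rw [pd2, Filter.EventuallyEq.fderiv_eq h, fderiv_sub_const]
  rfl

theorem convexOn_tangentGap {D : Set (E n)} {u : E n → ℝ} (hu : ConvexOn ℝ D u) (x₀ : E n) :
    ConvexOn ℝ D (tangentGap u x₀) := by
  have h := (hu.add ((-(fderiv ℝ u x₀).toLinearMap).convexOn hu.1)).add_const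
    (fderiv ℝ u x₀ x₀ - u x₀)
  refine h.congr fun x _ => ?_
  simp [tangentGap]
  ring

theorem MASetup.contDiffAt {Ω : Set (E n)} {u : E n → ℝ} (h : MASetup Ω u) {x : E n}
    (hx : x ∈ Ω) : ContDiffAt ℝ (⊤ : ℕ∞) u x :=
  h.2.2.2.2.1.contDiffAt (Filter.mem_of_superset (h.1.mem_nhds hx) subset_closure)

theorem MASetup.convexOn {Ω : Set (E n)} {u : E n → ℝ} (h : MASetup Ω u) :
    ConvexOn ℝ (closure Ω) u := h.2.2.2.2.2.1

theorem sublevel_tangentGap_eq {Ω V : Set (E n)} {u : E n → ℝ} {x₀ : E n} {σ s : ℝ}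
    (hVΩ : V ⊆ closure Ω) (hS : MASection Ω u x₀ s ⊆ V) (hσ : σ ≤ s) :
    {x ∈ V | tangentGap u x₀ x < σ} = MASection Ω u x₀ σ := by
  ext x
  refine ⟨fun hx => ⟨hVΩ hx.1, ?_⟩, fun hx => ⟨hS ⟨hx.1, ?_⟩, ?_⟩⟩
  · have := hx.2
    rw [tangentGap] at this
    linarith
  · linarith [hx.2]
  · rw [tangentGap]
    linarith [hx.2]

theorem isSublevelFamily_tangentGap {Ω V : Set (E n)} {u : E n → ℝ} {lam Lam : ℝ}
    (hlam : 0 < lam) (hu : MASetup Ω u) (hdet : DetBounds Ω u lam Lam) (hV : IsOpen V)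
    (hVΩ : V ⊆ Ω) {x₀ : E n} (hx₀ : x₀ ∈ V) {s : ℝ}
    (hS : CptIn (MASection Ω u x₀ s) V) : IsSublevelFamily V x₀ (tangentGap u x₀) s lam Lam := by
  have hVc : V ⊆ closure Ω := hVΩ.trans subset_closure
  have hSV : MASection Ω u x₀ s ⊆ V := subset_closure.trans hS.2
  have hsm : ∀ x ∈ V, ContDiffAt ℝ (⊤ : ℕ∞) (tangentGap u x₀) x := fun x hx =>
    contDiffAt_tangentGap x₀ (hu.contDiffAt (hVΩ hx))
  have hH : ∀ x ∈ V, Hess (tangentGap u x₀) x = Hess u x := fun x hx =>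
    hess_tangentGap x₀ (hu.contDiffAt (hVΩ hx))
  have hconv := convexOn_tangentGap hu.convexOn x₀
  have hnn : ∀ x ∈ V, 0 ≤ tangentGap u x₀ x := fun x hx => by
    have := hu.convexOn.add_fderiv_le (hVc hx₀) (hVc hx)
      ((hu.contDiffAt (hVΩ hx₀)).differentiableAt (by simp))
    rw [tangentGap]
    linarith
  have hcont : ∀ x ∈ V, ContinuousAt (tangentGap u x₀) x := fun x hx => (hsm x hx).continuousAt
  refine ⟨hV, hsm, fun x hx => ?_, fun x hx => ?_, hnn, ?_, fun σ hσ hσs => ?_⟩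
  · obtain ⟨r, hr, hrV⟩ := Metric.isOpen_iff.1 hV x hx
    refine (hconv.subset (hrV.trans hVc) (convex_ball x r)).hess_posDef Metric.isOpen_ball
      (fun y hy => hsm y (hrV hy)) (fun y hy => ?_) (Metric.mem_ball_self hr)
    rw [hH y (hrV hy)]
    exact (hlam.trans_le (hdet y (hVΩ (hrV hy))).1).ne'
  · rw [hH x hx]
    exact (hdet x (hVΩ hx)).2
  · rw [sublevel_tangentGap_eq hVc hSV le_rfl]
    exact hS.2
  · have hsub : closure {x ∈ V | tangentGap u x₀ x < σ} ⊆ closure (MASection Ω u x₀ s) := by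
      rw [← sublevel_tangentGap_eq hVc hSV le_rfl]
      exact closure_mono fun x hx => ⟨hx.1, hx.2.trans_le hσs⟩
    have hcl : closure {x ∈ V | tangentGap u x₀ x < σ} ⊆ V := hsub.trans hS.2
    have hcx : Convex ℝ {x ∈ V | tangentGap u x₀ x < σ} := by
      have heq : {x ∈ V | tangentGap u x₀ x < σ}
          = {x ∈ closure Ω | tangentGap u x₀ x < σ} := by
        rw [sublevel_tangentGap_eq hVc hSV hσs]
        ext x
        refine and_congr_right fun _ => ?_
        rw [tangentGap]
        constructor <;> intro _ <;> linarith
      rw [heq]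
      exact hconv.convex_lt σ
    exact {
      isOpen := ContinuousOn.isOpen_inter_preimage
        (fun x hx => (hcont x hx).continuousWithinAt) hV isOpen_Iio
      convex := hcx
      isCompact := hS.1.of_isClosed_subset isClosed_closure hsub
      mem := ⟨hx₀, by simpa [tangentGap] using hσ⟩
      smooth := fun x hx => hsm x hx.1
      continuousOn := fun x hx => (hcont x (hcl hx)).continuousWithinAt
      convexOn := hconv.subset (hcl.trans hVc) hcx.closure
      eq_zero := by simp [tangentGap]
      nonneg := fun x hx => hnn x (hcl hx)
      le := fun x hx => ContinuousWithinAt.closure_le hx (hcont x (hcl hx)).continuousWithinAt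
        continuousWithinAt_const fun y hy => hy.2.le
      ge := fun x hx => not_lt.1 fun hlt => hx.2 ⟨hcl hx.1, hlt⟩
      det_ge := fun x hx => by rw [hH x hx.1]; exact (hdet x (hVΩ hx.1)).1
      det_le := fun x hx => by rw [hH x hx.1]; exact (hdet x (hVΩ hx.1)).2 }

theorem exists_norm_lt_of_isOpen (hn : 1 ≤ n) {V : Set (E n)} (hV : IsOpen V) {x : E n}
    (hx : x ∈ V) : ∃ y ∈ V, ‖x‖ < ‖y‖ := by
  obtain ⟨w, hw, hxw⟩ : ∃ w : E n, w ≠ 0 ∧ 0 ≤ inner ℝ x w := by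
    by_cases h : x = 0
    · exact ⟨EuclideanSpace.single ⟨0, hn⟩ 1, by simp, by simp [h]⟩
    · exact ⟨x, h, real_inner_self_nonneg⟩
  have hc : ContinuousAt (fun ε : ℝ => x + ε • w) 0 := by fun_prop
  have hmem : ∀ᶠ ε in nhds (0 : ℝ), x + ε • w ∈ V :=
    hc.eventually_mem (hV.mem_nhds (by simpa using hx))
  obtain ⟨ε, hε, hεV⟩ := Filter.Eventually.exists_gt hmem
  refine ⟨_, hεV, ?_⟩
  refine lt_of_pow_lt_pow_left₀ 2 (norm_nonneg _) ?_
  rw [norm_add_sq_real, inner_smul_right, norm_smul]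
  have h1 : 0 < (‖ε‖ * ‖w‖) ^ 2 := by
    have := norm_pos_iff.2 hw
    have := norm_pos_iff.2 hε.ne'
    positivity
  have h2 := mul_nonneg hε.le hxw
  linarith

theorem norm_sq_lt_sSup_frontier (hn : 1 ≤ n) {V : Set (E n)} (hV : IsOpen V)
    (hVc : IsCompact (closure V)) {x : E n} (hx : x ∈ V) :
    ‖x‖ ^ 2 < sSup ((fun x : E n => ‖x‖ ^ 2) '' frontier V) := by
  obtain ⟨z, hz, hmax⟩ := hVc.exists_isMaxOn ⟨x, subset_closure hx⟩
    (f := fun x : E n => ‖x‖) (by fun_prop)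
  have hlt : ∀ y ∈ V, ‖y‖ < ‖z‖ := fun y hy => by
    obtain ⟨y', hy', h⟩ := exists_norm_lt_of_isOpen hn hV hy
    exact h.trans_le (hmax (subset_closure hy'))
  have hzf : z ∈ frontier V := by
    rw [hV.frontier_eq]
    exact ⟨hz, fun h => lt_irrefl _ (hlt z h)⟩
  have hb : BddAbove ((fun x : E n => ‖x‖ ^ 2) '' frontier V) :=
    ((hVc.of_isClosed_subset isClosed_frontier frontier_subset_closure).image
      (by fun_prop)).bddAbove
  exact (pow_lt_pow_left₀ (hlt x hx) (norm_nonneg _) two_ne_zero).trans_le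
    (le_csSup hb ⟨z, hzf, rfl⟩)

theorem integral_trace_tangentGap {Ω V : Set (E n)} {u : E n → ℝ} {lam Lam : ℝ}
    (hu : MASetup Ω u) (hVΩ : V ⊆ Ω) {x₀ : E n} {s t : ℝ} (hS : CptIn (MASection Ω u x₀ s) V)
    (h : IsSublevelFamily V x₀ (tangentGap u x₀) s lam Lam) (ht : 0 < t) (hts : t ≤ s) :
    ∫ x in {x ∈ V | tangentGap u x₀ x < t}, (cofU (tangentGap u x₀) x).trace
      = ∫ x in MASection Ω u x₀ t, (cofU u x).trace := by
  rw [← sublevel_tangentGap_eq (hVΩ.trans subset_closure) (subset_closure.trans hS.2) hts]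
  refine setIntegral_congr_fun (h.sublevel t ht hts).isOpen.measurableSet fun x hx => ?_
  simp only [cofU, hess_tangentGap x₀ (hu.contDiffAt (hVΩ hx.1))]

end

/-- Corollary 3.4: trace estimate for the cofactor matrix. -/
theorem cofactor_trace_estimate (n : ℕ) (hn : 2 ≤ n)
    (lam Lam : ℝ) (hlam : 0 < lam) (hlL : lam ≤ Lam) :
    ∃ C > 0, ∀ (Ω : Set (E n)) (u : E n → ℝ),
      MASetup Ω u → DetBounds Ω u lam Lam →
      ∀ V : Set (E n), IsOpen V → CptIn V Ω →
      ∀ x₀ ∈ V, ∀ t : ℝ, 0 < t → t < 1 / 4 →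
      (∃ g : E n → ℝ, IsGreen u V x₀ g) →
        (3 ≤ n → CptIn (MASection Ω u x₀ (2 * t)) V →
          (∫ x in MASection Ω u x₀ t, (cofU u x).trace) ≤
            C * t ^ (((n : ℝ) - 2) / 2) *
              (sSup ((fun x : E n => ‖x‖ ^ 2) '' frontier V) - ‖x₀‖ ^ 2)) ∧
        (n = 2 → CptIn (MASection Ω u x₀ (Real.sqrt t)) V →
          (∫ x in MASection Ω u x₀ t, (cofU u x).trace) ≤
            C * |Real.log t|⁻¹ *
              (sSup ((fun x : E n => ‖x‖ ^ 2) '' frontier V) - ‖x₀‖ ^ 2)) := by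
  have hn1 : 1 ≤ n := by omega
  have hL : 0 ≤ Lam := hlam.le.trans hlL
  set C₁ := 16 * distortionConst n lam Lam * (n / 2) * Lam * volumeConst n lam * √(2 ^ n)
  set C₂ := 5120 * distortionConst n lam Lam * Lam * volumeConst n lam
  have hD : 0 ≤ distortionConst n lam Lam := by rw [distortionConst]; positivity
  have hv : 0 ≤ volumeConst n lam := by rw [volumeConst]; positivity
  have hC₁ : 0 ≤ C₁ := by positivity
  have hC₂ : 0 ≤ C₂ := by positivity
  refine ⟨C₁ + C₂ + 1, by positivity, ?_⟩
  intro Ω u hu hdet V hV hVΩ x₀ hx₀ t ht ht4 _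
  have hVΩ' : V ⊆ Ω := subset_closure.trans hVΩ.2
  have hM : ∀ x ∈ V, ‖x‖ ^ 2 < sSup ((fun x : E n => ‖x‖ ^ 2) '' frontier V) := fun x hx =>
    norm_sq_lt_sSup_frontier hn1 hV hVΩ.1 hx
  have hf := sub_pos.2 (hM x₀ hx₀)
  refine ⟨fun _ hS => ?_, fun hn2 hS => ?_⟩
  · have h := isSublevelFamily_tangentGap hlam hu hdet hV hVΩ' hx₀ hS
    rw [← integral_trace_tangentGap hu hVΩ' hS h ht (by linarith)]
    refine (h.integral_trace_le_rpow hn1 hlam hL hM ht).trans ?_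
    gcongr
    change C₁ ≤ C₁ + C₂ + 1
    linarith
  · have hts : t ≤ √t := Real.le_sqrt_of_sq_le (by nlinarith)
    have h := isSublevelFamily_tangentGap hlam hu hdet hV hVΩ' hx₀ hS
    rw [← integral_trace_tangentGap hu hVΩ' hS h ht hts]
    refine (h.integral_trace_le_log hn2 hlam hL hM ht ht4).trans ?_
    gcongr
    change C₂ ≤ C₁ + C₂ + 1
    linarith
end
end

section
/- (Lemma 4.4, capacity upper bound in two dimensions.) Let n = 2. Then for every open set V ⊂⊂ Ω, every x₀ ∈ V, and every 0 < t < 1 with S_u(x₀, t^{1/2}) ⊂⊂ V, one has cap_{L_u}(cl(S_u(x₀, t)), V) ≤ (8 / (log t)²) · ∫_t^{t^{1/2}} μ(S_u(x₀, s)) s^{-2} ds, where μ is the Monge-Ampère measure of u. -/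
open MeasureTheory

noncomputable section

open Set Filter Topology
open scoped ContDiff

lemma contDiff_pd {n : ℕ} {f : E n → ℝ} (hf : ContDiff ℝ ∞ f) (i : Fin n) :
    ContDiff ℝ ∞ (fun x => pd f x i) :=
  (hf.fderiv_right (m := ∞) (by norm_cast)).clm_apply contDiff_const

lemma contDiff_pd2 {n : ℕ} {f : E n → ℝ} (hf : ContDiff ℝ ∞ f) (i j : Fin n) :
    ContDiff ℝ ∞ (fun x => pd2 f x i j) :=
  contDiff_pd (contDiff_pd hf j) i

lemma pd2_eq_fderiv_fderiv {n : ℕ} {f : E n → ℝ} {x : E n} (hf : ContDiffAt ℝ ∞ f x)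
    (i j : Fin n) :
    pd2 f x i j =
      fderiv ℝ (fderiv ℝ f) x (EuclideanSpace.single i 1) (EuclideanSpace.single j 1) := by
  have h : DifferentiableAt ℝ (fderiv ℝ f) x :=
    (hf.fderiv_right (m := ∞) (by norm_cast)).differentiableAt (by simp)
  simp only [pd2]
  rw [fderiv_clm_apply h (differentiableAt_const _)]
  simp

lemma pd2_comm {n : ℕ} {f : E n → ℝ} {x : E n} (hf : ContDiffAt ℝ ∞ f x) (i j : Fin n) :
    pd2 f x i j = pd2 f x j i := by
  rw [pd2_eq_fderiv_fderiv hf, pd2_eq_fderiv_fderiv hf]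
  exact hf.isSymmSndFDerivAt (by simpa using ENat.LEInfty.out) _ _

lemma pd_mul {n : ℕ} {f g : E n → ℝ} {x : E n} (hf : DifferentiableAt ℝ f x)
    (hg : DifferentiableAt ℝ g x) (i : Fin n) :
    pd (fun y => f y * g y) x i = pd f x i * g x + f x * pd g x i := by
  simp only [pd]
  rw [fderiv_fun_mul hf hg]
  simp
  ring

lemma Filter.EventuallyEq.pd_eq {n : ℕ} {f g : E n → ℝ} {x : E n} (h : f =ᶠ[𝓝 x] g)
    (i : Fin n) : pd f x i = pd g x i := by
  simp only [pd, h.fderiv_eq]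

lemma Filter.EventuallyEq.pd2_eq {n : ℕ} {f g : E n → ℝ} {x : E n} (h : f =ᶠ[𝓝 x] g)
    (i j : Fin n) : pd2 f x i j = pd2 g x i j :=
  Filter.EventuallyEq.pd_eq (h.eventuallyEq_nhds.mono fun _ hy => hy.pd_eq j) i

lemma Filter.EventuallyEq.hess_eq {n : ℕ} {f g : E n → ℝ} {x : E n} (h : f =ᶠ[𝓝 x] g) :
    Hess f x = Hess g x := by
  ext i j
  exact h.pd2_eq i j

/-- In dimension two, the cofactor matrix of the Hessian has divergence-free columns, so the
divergence of `U ∇v` is `2 det D²v`. -/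
lemma sum_pd_cofU_mul_pd {v : E 2 → ℝ} (hv : ContDiff ℝ ∞ v) (x : E 2) :
    ∑ i, pd (fun y => ∑ j, cofU v y i j * pd v y j) x i = 2 * (Hess v x).det := by
  have d1 : ∀ i x, DifferentiableAt ℝ (fun y => pd v y i) x := fun i x =>
    (contDiff_pd hv i).differentiable (by simp) x
  have d2 : ∀ i j x, DifferentiableAt ℝ (fun y => pd2 v y i j) x := fun i j x =>
    (contDiff_pd2 hv i j).differentiable (by simp) x
  have s : ∀ y, pd2 v y 1 0 = pd2 v y 0 1 := fun y => pd2_comm hv.contDiffAt 1 0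
  have e0 : (fun y => ∑ j, cofU v y 0 j * pd v y j)
      = fun y => pd2 v y 1 1 * pd v y 0 - pd2 v y 0 1 * pd v y 1 := by
    ext y
    simp [cofU, Hess, Matrix.adjugate_fin_two, Fin.sum_univ_two]
    ring
  have e1 : (fun y => ∑ j, cofU v y 1 j * pd v y j)
      = fun y => pd2 v y 0 0 * pd v y 1 - pd2 v y 0 1 * pd v y 0 := by
    ext y
    simp [cofU, Hess, Matrix.adjugate_fin_two, Fin.sum_univ_two, s]
    ring
  have pd_sub : ∀ {f g : E 2 → ℝ} (i : Fin 2), DifferentiableAt ℝ f x → DifferentiableAt ℝ g x →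
      pd (fun y => f y - g y) x i = pd f x i - pd g x i := by
    intro f g i hf hg
    simp only [pd]
    rw [fderiv_fun_sub hf hg]
    rfl
  have t1 : pd (fun y => pd2 v y 1 1) x 0 = pd (fun y => pd2 v y 0 1) x 1 :=
    pd2_comm (contDiff_pd hv 1).contDiffAt 0 1
  have t2 : pd (fun y => pd2 v y 0 1) x 0 = pd (fun y => pd2 v y 0 0) x 1 := by
    rw [show (fun y => pd2 v y 0 1) = fun y => pd2 v y 1 0 from funext fun y => (s y).symm]
    exact pd2_comm (contDiff_pd hv 0).contDiffAt 0 1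
  have r : ∀ i j, pd (fun y => pd v y j) x i = pd2 v x i j := fun i j => rfl
  rw [Fin.sum_univ_two, e0, e1, pd_sub _ ((d2 _ _ _).fun_mul (d1 _ _)) ((d2 _ _ _).fun_mul (d1 _ _)),
    pd_sub _ ((d2 _ _ _).fun_mul (d1 _ _)) ((d2 _ _ _).fun_mul (d1 _ _)), pd_mul (d2 _ _ _) (d1 _ _),
    pd_mul (d2 _ _ _) (d1 _ _), pd_mul (d2 _ _ _) (d1 _ _), pd_mul (d2 _ _ _) (d1 _ _), t1, t2]
  simp only [r, Matrix.det_fin_two, Hess, Matrix.of_apply, s]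
  ring

/-- Integration by parts against the smooth compactly supported field `U ∇v`. -/
lemma integral_sum_pd_mul_field {n : ℕ} {W : E n → Fin n → ℝ}
    (hW : ∀ i, ContDiff ℝ ∞ fun x => W x i) (hWc : ∀ i, HasCompactSupport fun x => W x i)
    {G : E n → ℝ} {C : NNReal} (hG : LipschitzWith C G) (hGc : HasCompactSupport G) :
    ∫ x, ∑ i, pd G x i * W x i = - ∫ x, G x * ∑ i, pd (fun y => W y i) x i := by
  have i1 : ∀ i, Integrable (fun x => pd G x i * W x i) := by
    intro i
    refine ((hW i).continuous.integrable_of_hasCompactSupport (hWc i)).bdd_mul (c := C)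
      (measurable_fderiv_apply_const ℝ G _).aestronglyMeasurable (ae_of_all _ fun x => ?_)
    refine ((fderiv ℝ G x).le_opNorm _).trans ?_
    simpa using norm_fderiv_le_of_lipschitz ℝ hG
  have i2 : ∀ i, Integrable (fun x => G x * pd (fun y => W y i) x i) := fun i =>
    (hG.continuous.mul (contDiff_pd (hW i) i).continuous).integrable_of_hasCompactSupport
      hGc.mul_right
  simp_rw [Finset.mul_sum]
  rw [integral_finsetSum _ fun i _ => i1 i, integral_finsetSum _ fun i _ => i2 i,
    ← Finset.sum_neg_distrib]
  refine Finset.sum_congr rfl fun i _ => ?_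
  obtain ⟨D, hD⟩ := (hW i).lipschitzWith_of_hasCompactSupport (hWc i) (by simp)
  have key := hD.integral_lineDeriv_mul_eq (μ := volume) hG hGc (EuclideanSpace.single i (1 : ℝ))
  have l : ∫ x, lineDeriv ℝ (fun x => W x i) x (EuclideanSpace.single i (1 : ℝ)) * G x
      = ∫ x, G x * pd (fun y => W y i) x i := by
    refine integral_congr_ae (ae_of_all _ fun x => ?_)
    dsimp only
    rw [((hW i).differentiable (by simp) x).lineDeriv_eq_fderiv, mul_comm]
    rfl
  have r : ∫ x, lineDeriv ℝ G x (-EuclideanSpace.single i (1 : ℝ)) * W x i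
      = - ∫ x, pd G x i * W x i := by
    rw [← integral_neg]
    refine integral_congr_ae ?_
    filter_upwards [hG.ae_differentiableAt] with x hx
    rw [hx.lineDeriv_eq_fderiv, map_neg, neg_mul]
    rfl
  rw [l, r] at key
  rw [key, neg_neg]

/-- Truncating `F` outside `[a, b]` and composing with a Lipschitz function yields a Lipschitz
function. -/
lemma exists_lipschitzWith_comp_clamp {n : ℕ} {a b : ℝ} (hab : a ≤ b) {F F' : ℝ → ℝ}
    (hF : ∀ s ∈ Icc a b, HasDerivAt F (F' s) s) (hF' : ContinuousOn F' (Icc a b))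
    {v : E n → ℝ} {C : NNReal} (hv : LipschitzWith C v) :
    ∃ D, LipschitzWith D fun x => F (max a (min (v x) b)) := by
  obtain ⟨M, hM⟩ := isCompact_Icc.exists_bound_of_continuousOn hF'
  have h1 : LipschitzOnWith (Real.toNNReal M) F (Icc a b) :=
    (convex_Icc a b).lipschitzOnWith_of_nnnorm_hasDerivWithin_le
      (fun s hs => (hF s hs).hasDerivWithinAt)
      fun s hs => by
        rw [← NNReal.coe_le_coe]
        exact (hM s hs).trans (Real.le_coe_toNNReal M)
  have h2 : LipschitzWith C fun x => max a (min (v x) b) := (hv.min_const b).const_max a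
  refine ⟨Real.toNNReal M * C, ?_⟩
  rw [← lipschitzOnWith_univ]
  exact h1.comp (h2.lipschitzOnWith (s := univ))
    fun x _ => ⟨le_max_left _ _, max_le hab (min_le_right _ _)⟩

/-- The gradient of `F (max a (min v b))`, for `F` antitone on `[a, b]`, vanishes at every point
where `v` is outside `(a, b)`. -/
lemma pd_comp_clamp {n : ℕ} {a b : ℝ} (hab : a ≤ b) {F F' : ℝ → ℝ}
    (hF : ∀ s ∈ Icc a b, HasDerivAt F (F' s) s) (hanti : AntitoneOn F (Icc a b))
    {v : E n → ℝ} {x : E n} (hv : DifferentiableAt ℝ v x) (i : Fin n) :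
    pd (fun x => F (max a (min (v x) b))) x i =
      (Ioo a b).indicator F' (v x) * pd v x i := by
  have hm : ∀ s, max a (min s b) ∈ Icc a b :=
    fun s => ⟨le_max_left _ _, max_le hab (min_le_right _ _)⟩
  by_cases hx : v x ∈ Ioo a b
  · have hev : (fun x => F (max a (min (v x) b))) =ᶠ[𝓝 x] F ∘ v := by
      filter_upwards [hv.continuousAt.preimage_mem_nhds (isOpen_Ioo.mem_nhds hx)] with y hy
      simp [min_eq_left hy.2.le, max_eq_right hy.1.le]
    rw [hev.pd_eq, indicator_of_mem hx, pd,
      ((hF _ (Ioo_subset_Icc_self hx)).comp_hasFDerivAt x hv.hasFDerivAt).fderiv]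
    simp [pd]
  · rw [indicator_of_notMem hx, zero_mul, pd]
    rw [mem_Ioo, not_and_or, not_lt, not_lt] at hx
    have : fderiv ℝ (fun x => F (max a (min (v x) b))) x = 0 := by
      rcases hx with hx | hx
      · refine IsLocalMax.fderiv_eq_zero (Eventually.of_forall fun y => ?_)
        simp only [min_eq_left (hx.trans hab), max_eq_left hx]
        exact hanti (left_mem_Icc.2 hab) (hm _) (hm _).1
      · refine IsLocalMin.fderiv_eq_zero (Eventually.of_forall fun y => ?_)
        simp only [min_eq_right hx, max_eq_right hab]
        exact hanti (hm _) (right_mem_Icc.2 hab) (hm _).2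
    simp [this]

lemma integral_indicator_inv_sq {a b : ℝ} (ha : 0 < a) (hab : a ≤ b) (c : ℝ) :
    ∫ s in a..b, (Ioi c).indicator (fun s => (s ^ 2)⁻¹) s = (max a (min c b))⁻¹ - b⁻¹ := by
  have hset : Ioc a b ∩ Ioi c = Ioc (max a (min c b)) b := by
    ext s
    simp only [mem_inter_iff, mem_Ioc, mem_Ioi, max_lt_iff, min_lt_iff]
    constructor
    · rintro ⟨⟨h1, h2⟩, h3⟩
      exact ⟨⟨h1, Or.inl h3⟩, h2⟩
    · rintro ⟨⟨h1, h3⟩, h2⟩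
      exact ⟨⟨h1, h2⟩, h3.resolve_right h2.not_gt⟩
  have hm : max a (min c b) ≤ b := max_le hab (min_le_right _ _)
  have hm0 : 0 < max a (min c b) := ha.trans_le (le_max_left _ _)
  rw [intervalIntegral.integral_of_le hab, setIntegral_indicator measurableSet_Ioi, hset,
    ← intervalIntegral.integral_of_le hm]
  have hpos : ∀ s ∈ uIcc (max a (min c b)) b, s ≠ 0 := fun s hs =>
    (hm0.trans_le (by rw [uIcc_of_le hm] at hs; exact hs.1)).ne'
  rw [intervalIntegral.integral_eq_sub_of_hasDerivAt (f := fun s => -s⁻¹)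
    (f' := fun s => (s ^ 2)⁻¹)
    (fun s hs => by simpa using (hasDerivAt_inv (hpos s hs)).fun_neg)
    (ContinuousOn.intervalIntegrable
      ((continuousOn_pow 2).inv₀ fun s hs => pow_ne_zero 2 (hpos s hs)))]
  ring

lemma hasCompactSupport_pd {n : ℕ} {f : E n → ℝ} (hf : HasCompactSupport f) (i : Fin n) :
    HasCompactSupport fun x => pd f x i :=
  hf.fderiv_apply ℝ _

lemma hasCompactSupport_pd_of_sub_const {n : ℕ} {f : E n → ℝ} {b : ℝ}
    (hf : HasCompactSupport fun x => f x - b) (i : Fin n) :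
    HasCompactSupport fun x => pd f x i := by
  have := hasCompactSupport_pd hf i
  simpa only [pd, fderiv_sub_const] using this

/-- A layer-cake formula: integrating a function over the sublevel sets of `v`. -/
lemma integral_inv_clamp_mul {n : ℕ} {v f : E n → ℝ} (hv : Continuous v) (hf : Integrable f)
    {a b : ℝ} (ha : 0 < a) (hab : a ≤ b) :
    ∫ x, ((max a (min (v x) b))⁻¹ - b⁻¹) * f x =
      ∫ s in a..b, (∫ x in {x | v x < s}, f x) / s ^ 2 := by
  have hpos : ∀ s ∈ uIcc a b, s ≠ 0 := fun s hs =>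
    (ha.trans_le (by rw [uIcc_of_le hab] at hs; exact hs.1)).ne'
  have hi : IntervalIntegrable (fun s : ℝ => (s ^ 2)⁻¹) volume a b :=
    ContinuousOn.intervalIntegrable
      ((continuousOn_id.pow 2).inv₀ fun s hs => pow_ne_zero 2 (hpos s hs))
  have hm : MeasurableSet {p : ℝ × E n | v p.2 < p.1} :=
    measurableSet_lt (hv.measurable.comp measurable_snd) measurable_fst
  have hint := ((intervalIntegrable_iff.1 hi).mul_prod hf).indicator hm
  have hswap := intervalIntegral_integral_swap (μ := volume)
    (f := fun s x => (Ioi (v x)).indicator (fun s => (s ^ 2)⁻¹) s * f x) (a := a) (b := b) (by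
      refine hint.congr (ae_of_all _ fun ⟨s, x⟩ => ?_)
      by_cases h : v x < s <;> simp [indicator, h])
  calc _ = ∫ x, ∫ s in a..b, (Ioi (v x)).indicator (fun s => (s ^ 2)⁻¹) s * f x := by
        refine integral_congr_ae (ae_of_all _ fun x => ?_)
        simp only [intervalIntegral.integral_mul_const, integral_indicator_inv_sq ha hab]
    _ = _ := by
        rw [← hswap]
        refine intervalIntegral.integral_congr fun s _ => ?_
        rw [← integral_indicator (measurableSet_lt hv.measurable measurable_const),
          ← integral_div]
        refine integral_congr_ae (ae_of_all _ fun x => ?_)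
        by_cases h : v x < s <;> simp [indicator, h]
        ring

/-- The logarithmic cutoff of `v` between the levels `a` and `b`: it equals `1` where `v ≤ a` and
`0` where `v ≥ b`. -/
def logCutoff {n : ℕ} (v : E n → ℝ) (a b : ℝ) (x : E n) : ℝ :=
  (Real.log b - Real.log (max a (min (v x) b))) / (Real.log b - Real.log a)

section LogCutoff

variable {n : ℕ} {v : E n → ℝ} {a b : ℝ}

lemma hasDerivAt_logCutoff_profile (ha : 0 < a) :
    ∀ s ∈ Icc a b, HasDerivAt (fun s => (Real.log b - Real.log s) / (Real.log b - Real.log a))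
      (-s⁻¹ / (Real.log b - Real.log a)) s := fun _ hs =>
  ((Real.hasDerivAt_log (ha.trans_le hs.1).ne').const_sub _).div_const _

lemma log_sub_log_pos (ha : 0 < a) (hab : a < b) : 0 < Real.log b - Real.log a :=
  sub_pos.2 (Real.log_lt_log ha hab)

lemma logCutoff_eq_one (ha : 0 < a) (hab : a < b) {x : E n} (hx : v x ≤ a) :
    logCutoff v a b x = 1 := by
  rw [logCutoff, min_eq_left (hx.trans hab.le), max_eq_left hx]
  exact div_self (log_sub_log_pos ha hab).ne'

lemma logCutoff_eq_zero (hab : a < b) {x : E n} (hx : b ≤ v x) : logCutoff v a b x = 0 := by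
  simp [logCutoff, min_eq_right hx, max_eq_right hab.le]

lemma logCutoff_nonneg (ha : 0 < a) (hab : a < b) (x : E n) : 0 ≤ logCutoff v a b x :=
  div_nonneg (sub_nonneg.2 (Real.log_le_log (ha.trans_le (le_max_left _ _))
    (max_le hab.le (min_le_right _ _)))) (log_sub_log_pos ha hab).le

lemma exists_lipschitzWith_logCutoff (ha : 0 < a) (hab : a < b) {C : NNReal}
    (hv : LipschitzWith C v) : ∃ D, LipschitzWith D (logCutoff v a b) :=
  exists_lipschitzWith_comp_clamp hab.le (hasDerivAt_logCutoff_profile ha)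
    ((continuousOn_id.inv₀ fun _ hs => (ha.trans_le hs.1).ne').neg.div_const _) hv

lemma pd_logCutoff (ha : 0 < a) (hab : a < b) {x : E n} (hv : DifferentiableAt ℝ v x)
    (i : Fin n) :
    pd (logCutoff v a b) x i =
      (Ioo a b).indicator (fun s => -s⁻¹ / (Real.log b - Real.log a)) (v x) * pd v x i := by
  refine pd_comp_clamp hab.le (hasDerivAt_logCutoff_profile ha) (fun _ hs _ _ hsr => ?_) hv i
  have := log_sub_log_pos ha hab
  have := Real.log_le_log (ha.trans_le hs.1) hsr
  dsimp only
  gcongr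

end LogCutoff

lemma exists_lipschitzWith_of_sub_const {n : ℕ} {v : E n → ℝ} (hv : ContDiff ℝ ∞ v) {b : ℝ}
    (hc : HasCompactSupport fun x => v x - b) : ∃ C, LipschitzWith C v := by
  obtain ⟨C, hC⟩ := (hv.sub contDiff_const).lipschitzWith_of_hasCompactSupport hc (by simp)
  exact ⟨C, LipschitzWith.of_dist_le_mul fun x y => by simpa using hC.dist_le_mul x y⟩

/-- The energy of the logarithmic cutoff of a smooth function in terms of the Monge-Ampère mass of
its sublevel sets. -/
lemma integral_energy_logCutoff {v : E 2 → ℝ} (hv : ContDiff ℝ ∞ v) {a b : ℝ} (ha : 0 < a)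
    (hab : a < b) (hc : HasCompactSupport fun x => v x - b) :
    ∫ x, ∑ i, ∑ j, cofU v x i j * pd (logCutoff v a b) x i * pd (logCutoff v a b) x j =
      2 / (Real.log b - Real.log a) ^ 2 *
        ∫ s in a..b, (∫ x in {x | v x < s}, (Hess v x).det) / s ^ 2 := by
  have hdv := hv.differentiable (by simp)
  obtain ⟨C, hC⟩ := exists_lipschitzWith_of_sub_const hv hc
  have hpc := hasCompactSupport_pd_of_sub_const hc
  set G : E 2 → ℝ := fun x => (max a (min (v x) b))⁻¹ - b⁻¹ with hG
  have hGd : ∀ s ∈ Icc a b, HasDerivAt (fun s => s⁻¹ - b⁻¹) (-(s ^ 2)⁻¹) s := fun s hs =>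
    (hasDerivAt_inv (ha.trans_le hs.1).ne').sub_const _
  obtain ⟨D, hD⟩ : ∃ D, LipschitzWith D G :=
    exists_lipschitzWith_comp_clamp hab.le hGd
      (((continuousOn_id.pow 2).inv₀ fun _ hs => pow_ne_zero 2 (ha.trans_le hs.1).ne').neg) hC
  have hGc : HasCompactSupport G := by
    refine hc.mono fun x hx hx0 => hx ?_
    simp [hG, sub_eq_zero.1 hx0, max_eq_right hab.le]
  have hGpd : ∀ x i, pd G x i = (Ioo a b).indicator (fun s => -(s ^ 2)⁻¹) (v x) * pd v x i :=
    fun x i => pd_comp_clamp hab.le hGd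
      (fun s hs r _ hsr => sub_le_sub_right (inv_anti₀ (ha.trans_le hs.1) hsr) _) (hdv x) i
  have hcof : ∀ i j, ContDiff ℝ ∞ fun x => cofU v x i j := by
    intro i j
    fin_cases i <;> fin_cases j <;>
      simp [cofU, Hess, Matrix.adjugate_fin_two, contDiff_pd2 hv, (contDiff_pd2 hv _ _).neg]
  have hparts := integral_sum_pd_mul_field (W := fun x i => ∑ j, cofU v x i j * pd v x j)
    (fun i => ContDiff.sum fun j _ => (hcof i j).mul (contDiff_pd hv j))
    (fun i => by
      simp only [Fin.sum_univ_two]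
      exact (hpc 0).mul_left.add (hpc 1).mul_left) hD hGc
  have hdet : Integrable fun x => (Hess v x).det := by
    simp only [Matrix.det_fin_two, Hess, Matrix.of_apply]
    have hp : ∀ i j, HasCompactSupport fun x => pd2 v x i j := fun i j =>
      hasCompactSupport_pd (hpc j) i
    have hk := fun i j => (contDiff_pd2 hv i j).continuous
    exact (((hk 0 0).mul (hk 1 1)).integrable_of_hasCompactSupport (hp 1 1).mul_left).sub
      (((hk 0 1).mul (hk 1 0)).integrable_of_hasCompactSupport (hp 1 0).mul_left)
  simp only [sum_pd_cofU_mul_pd hv] at hparts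
  have hpt : ∀ x, ∑ i, ∑ j, cofU v x i j * pd (logCutoff v a b) x i * pd (logCutoff v a b) x j
      = -(1 / (Real.log b - Real.log a) ^ 2) *
        ∑ i, pd G x i * ∑ j, cofU v x i j * pd v x j := by
    intro x
    simp only [pd_logCutoff ha hab (hdv x), hGpd, Finset.mul_sum]
    refine Finset.sum_congr rfl fun i _ => Finset.sum_congr rfl fun j _ => ?_
    by_cases hx : v x ∈ Ioo a b
    · simp only [indicator_of_mem hx]
      field_simp
    · simp [indicator_of_notMem hx]
  simp only [hpt]
  rw [integral_const_mul, hparts, ← integral_inv_clamp_mul hv.continuous hdet ha hab.le]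
  have : ∀ x, G x * (2 * (Hess v x).det) = 2 * (G x * (Hess v x).det) := fun x => by ring
  simp only [this]
  rw [integral_const_mul]
  ring

lemma fderiv_fderiv_apply_self_nonneg {n : ℕ} {s : Set (E n)} {f : E n → ℝ} {x : E n}
    (hs : s ∈ 𝓝 x) (hconv : ConvexOn ℝ s f) (hf : ContDiffAt ℝ ∞ f x) (w : E n) :
    0 ≤ fderiv ℝ (fderiv ℝ f) x w w := by
  have hdiff : ∀ᶠ y in 𝓝 x, DifferentiableAt ℝ f y :=
    ((hf.of_le (m := 1) (by exact_mod_cast le_top)).eventually (by simp)).mono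
      fun y hy => hy.differentiableAt (by simp)
  obtain ⟨r, hr, hball⟩ := Metric.mem_nhds_iff.1 (inter_mem hs hdiff)
  set γ : ℝ →ᵃ[ℝ] E n := AffineMap.lineMap x (x + w) with hγ
  have hγ' : ∀ t, HasDerivAt γ w t := fun t => by
    simpa using AffineMap.hasDerivAt_lineMap (a := x) (b := x + w) (x := t)
  have hγ0 : γ 0 = x := by simp [hγ]
  set T : Set ℝ := γ ⁻¹' Metric.ball x r with hT
  have hT0 : T ∈ 𝓝 (0 : ℝ) :=
    (hγ' 0).continuousAt.preimage_mem_nhds (by rw [hγ0]; exact Metric.ball_mem_nhds x hr)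
  have hcv : ConvexOn ℝ T (f ∘ γ) :=
    (hconv.subset (fun y hy => (hball hy).1) (convex_ball x r)).comp_affineMap γ
  have hd : ∀ t ∈ T, HasDerivAt (f ∘ γ) (fderiv ℝ f (γ t) w) t := fun t ht =>
    ((hball ht).2.hasFDerivAt).comp_hasDerivAt t (hγ' t)
  have hmono := hcv.monotoneOn_deriv fun t ht => (hd t ht).differentiableAt
  have h2 : DifferentiableAt ℝ (fderiv ℝ f) (γ 0) := by
    rw [hγ0]
    exact (hf.fderiv_right (m := ∞) (by norm_cast)).differentiableAt (by simp)
  have hdd : HasDerivAt (deriv (f ∘ γ)) (fderiv ℝ (fderiv ℝ f) x w w) 0 := by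
    have := (h2.hasFDerivAt.comp_hasDerivAt (0 : ℝ) (hγ' 0)).clm_apply (hasDerivAt_const _ w)
    rw [hγ0] at this
    refine HasDerivAt.congr_of_eventuallyEq (by simpa using this) ?_
    filter_upwards [hT0] with t ht using (hd t ht).deriv
  rw [← hdd.deriv, ← derivWithin_of_mem_nhds hT0]
  exact hmono.derivWithin_nonneg

lemma cofU_quadratic_nonneg {s : Set (E 2)} {f : E 2 → ℝ} {x : E 2} (hs : s ∈ 𝓝 x)
    (hconv : ConvexOn ℝ s f) (hf : ContDiffAt ℝ ∞ f x) (p : Fin 2 → ℝ) :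
    0 ≤ ∑ i, ∑ j, cofU f x i j * p i * p j := by
  have h := fderiv_fderiv_apply_self_nonneg hs hconv hf
    (p 1 • EuclideanSpace.single 0 1 - p 0 • EuclideanSpace.single 1 1)
  simp only [map_sub, map_smul, _root_.sub_apply, _root_.smul_apply,
    ← pd2_eq_fderiv_fderiv hf, smul_eq_mul] at h
  simp only [Fin.sum_univ_two, cofU, Hess, Matrix.adjugate_fin_two, Matrix.of_apply,
    Matrix.cons_val', Matrix.cons_val_zero, Matrix.cons_val_one, Matrix.cons_val_fin_one]
  linarith

lemma hess_sub_affine {n : ℕ} {f : E n → ℝ} {x : E n} (hf : ContDiffAt ℝ ∞ f x)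
    (c : ℝ) (L : E n →L[ℝ] ℝ) (z : E n) :
    Hess (fun y => f y - (c + L (y - z))) x = Hess f x := by
  have hdiff : ∀ᶠ y in 𝓝 x, DifferentiableAt ℝ f y :=
    ((hf.of_le (m := 1) (by exact_mod_cast le_top)).eventually (by simp)).mono
      fun y hy => hy.differentiableAt (by simp)
  ext i j
  have hev : (fun y => pd (fun y => f y - (c + L (y - z))) y j) =ᶠ[𝓝 x]
      fun y => pd f y j - L (EuclideanSpace.single j 1) := by
    filter_upwards [hdiff] with y hy
    have hL : HasFDerivAt (fun y => c + L (y - z)) L y :=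
      (L.hasFDerivAt.comp y ((hasFDerivAt_id y).sub_const z)).const_add c
    simp only [pd]
    rw [(hy.hasFDerivAt.fun_sub hL).fderiv]
    rfl
  change pd (fun y => pd (fun y => f y - (c + L (y - z))) y j) x i = pd (fun y => pd f y j) x i
  rw [hev.pd_eq]
  simp only [pd, fderiv_sub_const]

/-- Smooth truncation of a function near a sublevel set compactly contained in an open set. -/
lemma exists_contDiff_eqOn_sublevel {n : ℕ} {V : Set (E n)} (hV : IsOpen V) {f : E n → ℝ}
    (hf : ∀ x ∈ V, ContDiffAt ℝ ∞ f x) {b : ℝ} {K : Set (E n)} (hK : IsCompact K) (hKV : K ⊆ V)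
    (hfK : ∀ x ∈ V, f x < b → x ∈ K) :
    ∃ v : E n → ℝ, ContDiff ℝ ∞ v ∧ (HasCompactSupport fun x => v x - b) ∧
      (∀ x, v x < b ↔ x ∈ V ∧ f x < b) ∧ ∀ x ∈ V, f x < b → v x = f x := by
  obtain ⟨O, hO, hKO, hOV, hOc⟩ := exists_open_between_and_isCompact_closure hK hV hKV
  obtain ⟨χ, hχ, hχr, hχs, hχ1⟩ := exists_contMDiff_support_eq_eq_one_iff (n := ⊤)
    (modelWithCornersSelf ℝ (E n)) hO hK.isClosed hKO
  have hχ0 : ∀ x, 0 ≤ χ x := fun x => (hχr (mem_range_self x)).1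
  have hts : tsupport χ = closure O := by rw [tsupport, hχs]
  have heq : ∀ x ∈ V, f x < b → b + χ x * (f x - b) = f x := fun x hx hb => by
    rw [(hχ1 x).1 (hfK x hx hb)]
    ring
  refine ⟨fun x => b + χ x * (f x - b), ?_, ?_, fun x => ⟨fun h => ?_, fun h => ?_⟩, heq⟩
  · refine contDiff_const.add (contDiff_iff_contDiffAt.2 fun x => ?_)
    by_cases hx : x ∈ tsupport χ
    · exact hχ.contDiff.contDiffAt.mul ((hf x (hOV (hts ▸ hx))).sub contDiffAt_const)
    · refine (contDiffAt_const (c := (0 : ℝ))).congr_of_eventuallyEq ?_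
      filter_upwards [(isClosed_tsupport χ).isOpen_compl.mem_nhds hx] with y hy
      rw [image_eq_zero_of_notMem_tsupport hy, zero_mul]
  · have hc : HasCompactSupport χ := by rwa [HasCompactSupport, hts]
    simp only [add_sub_cancel_left]
    exact hc.mul_right (f' := fun x => f x - b)
  · have hχx : χ x ≠ 0 := fun h0 => by simp [h0] at h
    refine ⟨hOV (subset_closure (hχs ▸ hχx)), ?_⟩
    by_contra! hb
    nlinarith [mul_nonneg (hχ0 x) (sub_nonneg.2 hb)]
  · exact (heq x h.1 h.2).trans_lt h.2

/-- Lemma 4.4: capacity upper bound in two dimensions. -/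
theorem capacity_upper_bound_dim_two
    (Ω : Set (E 2)) (u : E 2 → ℝ) (hset : MASetup Ω u)
    (V : Set (E 2)) (hV : IsOpen V) (hVΩ : CptIn V Ω)
    (x₀ : E 2) (hx₀ : x₀ ∈ V) (t : ℝ) (ht : 0 < t) (ht1 : t < 1)
    (hS : CptIn (MASection Ω u x₀ (Real.sqrt t)) V) :
    capacity u (closure (MASection Ω u x₀ t)) V ≤
      (8 / (Real.log t) ^ 2) *
        ∫ s in t..Real.sqrt t, maMeasure u (MASection Ω u x₀ s) / s ^ 2 := by
  obtain ⟨hΩ, -, -, -, hu, hconv, -⟩ := hset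
  have hVΩ' : V ⊆ Ω := subset_closure.trans hVΩ.2
  have huΩ : ∀ x ∈ Ω, ContDiffAt ℝ ∞ u x := fun x hx =>
    hu.contDiffAt (mem_of_superset (hΩ.mem_nhds hx) subset_closure)
  set b := Real.sqrt t with hb
  have hb0 : 0 < b := Real.sqrt_pos.2 ht
  have hbsq : b ^ 2 = t := Real.sq_sqrt ht.le
  have hb1 : b < 1 := by nlinarith
  have htb : t < b := by nlinarith
  set f : E 2 → ℝ := fun y => u y - (u x₀ + fderiv ℝ u x₀ (y - x₀)) with hf
  have hfV : ∀ x ∈ V, ContDiffAt ℝ ∞ f x := fun x hx =>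
    (huΩ x (hVΩ' hx)).sub
      (contDiffAt_const.add ((fderiv ℝ u x₀).contDiff.contDiffAt.comp x
        (contDiffAt_id.sub contDiffAt_const)))
  have hsec : ∀ s ≤ b, MASection Ω u x₀ s = {x | x ∈ V ∧ f x < s} := by
    intro s hs
    ext x
    constructor
    · rintro ⟨hx, hxs⟩
      exact ⟨hS.2 (subset_closure ⟨hx, by linarith⟩), by simp only [hf]; linarith⟩
    · rintro ⟨hx, hxs⟩
      exact ⟨subset_closure (hVΩ' hx), by simp only [hf] at hxs; linarith⟩
  obtain ⟨v, hv, hvc, hvb, hvf⟩ := exists_contDiff_eqOn_sublevel hV hfV (b := b) hS.1 hS.2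
    fun x hx hxb => subset_closure (by rw [hsec b le_rfl]; exact ⟨hx, hxb⟩)
  have hsec' : ∀ s ≤ b, MASection Ω u x₀ s = {x | v x < s} := by
    intro s hs
    rw [hsec s hs]
    ext x
    constructor
    · rintro ⟨hx, hxs⟩
      change v x < s
      rwa [hvf x hx (hxs.trans_le hs)]
    · intro hx
      obtain ⟨h1, h2⟩ := (hvb x).1 (lt_of_lt_of_le hx hs)
      exact ⟨h1, by rw [← hvf x h1 h2]; exact hx⟩
  have hopen : IsOpen {x | v x < b} := isOpen_lt hv.continuous continuous_const
  have hhess : ∀ x, v x < b → Hess u x = Hess v x := by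
    intro x hx
    rw [← hess_sub_affine (huΩ x (hVΩ' ((hvb x).1 hx).1)) (u x₀) (fderiv ℝ u x₀) x₀]
    refine Filter.EventuallyEq.hess_eq ?_
    filter_upwards [hopen.mem_nhds hx] with y hy
    exact (hvf y ((hvb y).1 hy).1 ((hvb y).1 hy).2).symm
  have hpd0 : ∀ x, ¬ v x < b → ∀ i, pd (logCutoff v t b) x i = 0 := fun x hx i => by
    rw [pd_logCutoff ht htb (hv.differentiable (by simp) x),
      indicator_of_notMem fun h => hx h.2, zero_mul]
  have henergy : ∫ x in V, ∑ i, ∑ j,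
        cofU u x i j * pd (logCutoff v t b) x i * pd (logCutoff v t b) x j =
      (8 / (Real.log t) ^ 2) *
        ∫ s in t..b, maMeasure u (MASection Ω u x₀ s) / s ^ 2 := by
    rw [setIntegral_eq_integral_of_forall_compl_eq_zero fun x hx => by
      simp [hpd0 x fun h => hx ((hvb x).1 h).1]]
    have hcof : ∀ x, (∑ i, ∑ j,
          cofU u x i j * pd (logCutoff v t b) x i * pd (logCutoff v t b) x j) =
        ∑ i, ∑ j, cofU v x i j * pd (logCutoff v t b) x i * pd (logCutoff v t b) x j := by
      intro x
      by_cases hx : v x < b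
      · simp only [cofU, hhess x hx]
      · simp [hpd0 x hx]
    simp only [hcof]
    rw [integral_energy_logCutoff hv ht htb hvc]
    congr 1
    · rw [hb, Real.log_sqrt ht.le]
      have := (Real.log_neg ht ht1).ne
      field_simp
      ring
    · refine intervalIntegral.integral_congr fun s hs => ?_
      rw [uIcc_of_le htb.le] at hs
      rw [maMeasure, hsec' s hs.2, setIntegral_congr_fun
        (measurableSet_lt hv.continuous.measurable measurable_const)
        fun x (hx : v x < s) => congrArg Matrix.det (hhess x (hx.trans_le hs.2))]
  rw [← henergy]
  refine csInf_le ⟨0, ?_⟩ ⟨logCutoff v t b, ?_, ?_, ?_, ?_, rfl⟩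
  · rintro e ⟨Φ, -, -, -, -, rfl⟩
    exact setIntegral_nonneg hV.measurableSet fun x hx =>
      cofU_quadratic_nonneg (mem_of_superset (hΩ.mem_nhds (hVΩ' hx)) subset_closure) hconv
        (huΩ x (hVΩ' hx)) _
  · obtain ⟨C, hC⟩ := exists_lipschitzWith_of_sub_const hv hvc
    exact exists_lipschitzWith_logCutoff ht htb hC
  · refine hvc.mono fun x hx hx0 => hx (logCutoff_eq_zero htb (sub_eq_zero.1 hx0).ge)
  · refine (closure_mono fun x hx => ?_).trans hS.2
    rw [hsec' b le_rfl]
    by_contra h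
    exact hx (logCutoff_eq_zero htb (not_lt.1 h))
  · intro x hx
    have hcl : closure (MASection Ω u x₀ t) ⊆ {x | v x ≤ t} :=
      closure_minimal (by rw [hsec' t htb.le]; exact fun x (hx : v x < t) => hx.le)
        (isClosed_le hv.continuous continuous_const)
    exact (logCutoff_eq_one ht htb (hcl hx)).ge
end
end
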